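/- Let I ⊂ ℝ be a compact interval, f = (f₁,…,f_n) : I → ℝⁿ a C^(n) map whose Wronskian det(f_i^(j)(x))_{1≤i,j≤n} is nonzero for every x ∈ I, let ψ be an approximation function and λ ∈ C²(I). If the series ∑_{h=1}^∞ h^{n−1} ψ(h) diverges, then the Lebesgue measure of A_n(ψ,λ) equals the Lebesgue measure of I, i.e. |A_n(ψ,λ)| = |I|. -/

import Mathlib

open MeasureTheory Filter Set

/-- Distance from a real number to the nearest integer. -/
noncomputable def nearestIntDist (x : ℝ) : ℝ := |x - round x|

/-- Generalized Rolle theorem for a chain of derivatives. -/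
theorem exists_zero_of_chain (j : ℕ) : ∀ (D : ℕ → ℝ → ℝ) (U : Set ℝ), U.OrdConnected →
    (∀ i < j, ∀ t ∈ U, HasDerivAt (D i) (D (i + 1) t) t) →
    ∀ z : Fin (j + 1) → ℝ, StrictMono z → (∀ i, z i ∈ U) → (∀ i, D 0 (z i) = 0) →
    ∃ ξ ∈ U, D j ξ = 0 := by
  induction j with
  | zero => intro D U _ _ z _ hzU hz; exact ⟨z 0, hzU 0, hz 0⟩
  | succ j ih =>
    intro D U hU hD z hz hzU h0
    have key : ∀ i : Fin (j + 1), ∃ ξ ∈ Ioo (z i.castSucc) (z i.succ), D 1 ξ = 0 := by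
      intro i
      have hsub : Icc (z i.castSucc) (z i.succ) ⊆ U := hU.out (hzU _) (hzU _)
      exact exists_hasDerivAt_eq_zero (hz (Fin.castSucc_lt_succ))
        (fun t ht => (hD 0 (by omega) t (hsub ht)).continuousAt.continuousWithinAt)
        (by rw [h0, h0]) (fun t ht => hD 0 (by omega) t (hsub (Ioo_subset_Icc_self ht)))
    choose w hw hw0 using key
    refine ih (fun i => D (i + 1)) U hU (fun i hi t ht => hD (i + 1) (by omega) t ht) w ?_ ?_ hw0
    · rw [Fin.strictMono_iff_lt_succ]
      intro i
      have h1 := (hw i.castSucc).2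
      have h2 := (hw i.succ).1
      rw [← Fin.succ_castSucc] at h2
      exact h1.trans h2
    · intro i
      exact hU.out (hzU i.castSucc) (hzU i.succ) (Ioo_subset_Icc_self (hw i))

/-- Error formula for Lagrange interpolation. -/
theorem lagrange_error (j : ℕ) (D : ℕ → ℝ → ℝ) (U : Set ℝ) (hU : U.OrdConnected)
    (hD : ∀ i < j, ∀ t ∈ U, HasDerivAt (D i) (D (i + 1) t) t)
    (P : Finset ℝ) (hP : P.card = j) (hPU : ∀ p ∈ P, p ∈ U) (x : ℝ) (hx : x ∈ U) (hxP : x ∉ P) :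
    ∃ ξ ∈ U, D 0 x = (∑ p ∈ P, D 0 p * ∏ q ∈ P.erase p, (x - q) / (p - q)) +
      D j ξ / (j.factorial : ℝ) * ∏ p ∈ P, (x - p) := by
  classical
  set L := Lagrange.interpolate P id (fun p => D 0 p) with hL
  have hne : ∏ p ∈ P, (x - p) ≠ 0 := Finset.prod_ne_zero_iff.2 fun p hp h => hxP (by
    rw [sub_eq_zero.1 h]; exact hp)
  set c := (D 0 x - L.eval x) / ∏ p ∈ P, (x - p) with hc
  set N := Lagrange.nodal P (id : ℝ → ℝ) with hN
  set p := L + Polynomial.C c * N with hp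
  have hNx : ∀ t, N.eval t = ∏ p ∈ P, (t - p) := by
    intro t; simp [hN, Lagrange.eval_nodal]
  have hNd : N.degree = j := by rw [hN, Lagrange.degree_nodal, hP]
  have hNnd : N.natDegree = j := by rw [hN, Lagrange.natDegree_nodal, hP]
  have hNm : N.Monic := Lagrange.nodal_monic
  have hLd : L.degree < j := by
    have := Lagrange.degree_interpolate_lt (s := P) (v := (id : ℝ → ℝ)) (fun p => D 0 p)
      (Function.injective_id.injOn)
    rwa [hP] at this
  have hpj : Polynomial.derivative^[j] p = Polynomial.C (c * j.factorial) := by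
    rw [hp, iterate_map_add, Polynomial.iterate_derivative_C_mul,
      Polynomial.iterate_derivative_eq_zero_of_degree_lt hLd, zero_add]
    have : Polynomial.derivative^[j] N = Polynomial.C (j.factorial : ℝ) := by
      have h1 := Polynomial.natDegree_iterate_derivative N j
      rw [hNnd, Nat.sub_self] at h1
      rw [Polynomial.eq_C_of_natDegree_le_zero h1, Polynomial.coeff_iterate_derivative, zero_add,
        Nat.descFactorial_self]
      have : N.coeff j = 1 := by rw [← hNnd]; exact hNm
      rw [this]; simp
    rw [this, ← Polynomial.C_mul]
  have hLP : ∀ q ∈ P, p.eval q = D 0 q := by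
    intro q hq
    have h1 : N.eval q = 0 := by rw [hNx]; exact Finset.prod_eq_zero hq (sub_self q)
    have h2 := Lagrange.eval_interpolate_at_node (s := P) (v := (id : ℝ → ℝ)) (fun p => D 0 p)
      (Function.injective_id.injOn) hq
    simp only [id] at h2
    simp [hp, h1, ← h2, hL]
  have hpx : p.eval x = D 0 x := by
    simp only [hp, Polynomial.eval_add, Polynomial.eval_mul, Polynomial.eval_C, hNx, hc]
    rw [div_mul_cancel₀ _ hne]; ring
  set Z := insert x P with hZ
  have hZc : Z.card = j + 1 := by rw [hZ, Finset.card_insert_of_notMem hxP, hP]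
  obtain ⟨ξ, hξ, h⟩ := exists_zero_of_chain j
    (fun i t => D i t - (Polynomial.derivative^[i] p).eval t) U hU
    (fun i hi t ht => by
      have := (hD i hi t ht).sub ((Polynomial.derivative^[i] p).hasDerivAt t)
      rw [Function.iterate_succ_apply']
      exact this)
    (Z.orderEmbOfFin hZc) (Z.orderEmbOfFin hZc).strictMono
    (fun i => by
      have := Z.orderEmbOfFin_mem hZc i
      rcases Finset.mem_insert.1 this with h | h
      · rw [h]; exact hx
      · exact hPU _ h)
    (fun i => by
      have := Z.orderEmbOfFin_mem hZc i
      rcases Finset.mem_insert.1 this with h | h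
      · simp [h, hpx]
      · simp [hLP _ h])
  refine ⟨ξ, hξ, ?_⟩
  have hf : (j.factorial : ℝ) ≠ 0 := by positivity
  have hcξ : D j ξ / j.factorial = c := by
    rw [hpj, Polynomial.eval_C, sub_eq_zero] at h
    rw [h]; field_simp
  rw [hcξ, hc, div_mul_cancel₀ _ hne]
  have : L.eval x = ∑ p ∈ P, D 0 p * ∏ q ∈ P.erase p, (x - q) / (p - q) := by
    rw [hL, Lagrange.interpolate_apply, Polynomial.eval_finsetSum]
    refine Finset.sum_congr rfl fun p hp => ?_
    rw [Polynomial.eval_mul, Polynomial.eval_C, Lagrange.basis, Polynomial.eval_prod]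
    congr 1
    refine Finset.prod_congr rfl fun q hq => ?_
    simp [Lagrange.basisDivisor, div_eq_inv_mul]
  rw [this]; ring

theorem exists_separated (η : ℝ) (hη : 0 < η) (E : Set ℝ) (m : ℕ)
    (h : ENNReal.ofReal (2 * m * η) < volume E) :
    ∃ P : Finset ℝ, P.card = m + 1 ∧ (∀ p ∈ P, p ∈ E) ∧
      ∀ p ∈ P, ∀ q ∈ P, p ≠ q → η ≤ |p - q| := by
  classical
  induction m with
  | zero =>
    have : E.Nonempty := by
      by_contra h0
      rw [not_nonempty_iff_eq_empty] at h0
      simp [h0] at h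
    obtain ⟨x, hx⟩ := this
    exact ⟨{x}, by simp, by simpa using hx, by simp +contextual⟩
  | succ m ih =>
    obtain ⟨P, hPc, hPE, hP⟩ := ih (lt_of_le_of_lt (ENNReal.ofReal_le_ofReal (by
      push_cast; nlinarith)) h)
    have : ∃ x ∈ E, ∀ p ∈ P, η ≤ |x - p| := by
      by_contra! hcon
      have hsub : E ⊆ ⋃ p ∈ P, Metric.ball p η := by
        intro x hx
        obtain ⟨p, hp, hlt⟩ := hcon x hx
        exact mem_biUnion hp (by rwa [Metric.mem_ball, Real.dist_eq])
      have h1 : volume E ≤ ENNReal.ofReal (2 * (m + 1 : ℕ) * η) := by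
        refine (measure_mono hsub).trans ((measure_biUnion_finset_le _ _).trans ?_)
        simp only [Real.volume_ball, Finset.sum_const, hPc]
        rw [nsmul_eq_mul, ← ENNReal.ofReal_natCast, ← ENNReal.ofReal_mul (by positivity)]
        apply ENNReal.ofReal_le_ofReal
        apply le_of_eq; ring
      exact absurd h (not_lt.2 h1)
    obtain ⟨x, hx, hxP⟩ := this
    have hxn : x ∉ P := fun hmem => by
      have := hxP x hmem
      simp at this; linarith
    refine ⟨insert x P, by rw [Finset.card_insert_of_notMem hxn, hPc], ?_, ?_⟩
    · intro p hp
      rcases Finset.mem_insert.1 hp with rfl | hp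
      · exact hx
      · exact hPE p hp
    · intro p hp q hq hpq
      rcases Finset.mem_insert.1 hp with h1 | hp <;> rcases Finset.mem_insert.1 hq with h2 | hq
      · exact absurd (h1.trans h2.symm) hpq
      · rw [h1]; exact hxP q hq
      · rw [h2, abs_sub_comm]; exact hxP p hp
      · exact hP p hp q hq hpq

theorem interpolation_bound (P : Finset ℝ) (h : ℝ → ℝ) (ε M x : ℝ) (hM : 1 ≤ M)
    (hh : ∀ p ∈ P, |h p| ≤ ε)
    (hq : ∀ p ∈ P, ∀ q ∈ P, p ≠ q → |x - q| ≤ M * |p - q|) :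
    |∑ p ∈ P, h p * ∏ q ∈ P.erase p, (x - q) / (p - q)| ≤ P.card * ε * M ^ P.card := by
  refine (Finset.abs_sum_le_sum_abs _ _).trans ?_
  have : ∀ p ∈ P, |h p * ∏ q ∈ P.erase p, (x - q) / (p - q)| ≤ ε * M ^ P.card := by
    intro p hp
    rw [abs_mul, Finset.abs_prod]
    have hε : 0 ≤ ε := (abs_nonneg _).trans (hh p hp)
    refine mul_le_mul (hh p hp) ?_ (Finset.prod_nonneg fun _ _ => abs_nonneg _) hε
    have h1 : ∏ q ∈ P.erase p, |(x - q) / (p - q)| ≤ ∏ q ∈ P.erase p, M := by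
      refine Finset.prod_le_prod (fun _ _ => abs_nonneg _) fun q hq' => ?_
      have hne : p ≠ q := (Finset.ne_of_mem_erase hq').symm
      rw [abs_div, div_le_iff₀ (abs_pos.2 (sub_ne_zero.2 hne))]
      exact hq p hp q (Finset.mem_of_mem_erase hq') hne
    refine h1.trans ?_
    rw [Finset.prod_const]
    exact pow_le_pow_right₀ hM (Finset.card_le_card (Finset.erase_subset _ _))
  refine (Finset.sum_le_sum this).trans ?_
  rw [Finset.sum_const, nsmul_eq_mul, mul_assoc]

theorem nodes_bound (j : ℕ) (A₁ A₂ s θ ε c r : ℝ) (hr : 0 < r) (hθ : 0 < θ) (hθ2 : θ ≤ 2)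
    (hs : 0 ≤ s) (hA₂ : 0 ≤ A₂)
    (D : ℕ → ℝ → ℝ) (hD : ∀ i < j, ∀ t ∈ Metric.closedBall c r, HasDerivAt (D i) (D (i + 1) t) t)
    (hlow : ∀ t ∈ Metric.closedBall c r, A₁ * s ≤ |D j t|)
    (P : Finset ℝ) (hPc : P.card = j + 1) (hPK : ∀ p ∈ P, p ∈ Metric.closedBall c r)
    (hsep : ∀ p ∈ P, ∀ q ∈ P, p ≠ q → θ * r ≤ |p - q|)
    (hPε : ∀ p ∈ P, |D 0 p| ≤ ε) :
    A₁ * s * (θ * r) ^ j ≤ j.factorial * ((j + 1) * ε * (2 / θ) ^ j) ∧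
    ((∀ t ∈ Metric.closedBall c r, |D j t| ≤ A₂ * s) → ∀ x ∈ Metric.closedBall c r,
      |D 0 x| ≤ (j + 1) * ε * (2 / θ) ^ j + A₂ * s * (2 * r) ^ j) := by
  classical
  have hM : 1 ≤ 2 / θ := by rw [le_div_iff₀ hθ]; linarith
  have hdist : ∀ x ∈ Metric.closedBall c r, ∀ y ∈ Metric.closedBall c r, |x - y| ≤ 2 * r := by
    intro x hx y hy
    rw [Metric.mem_closedBall] at hx hy
    rw [← Real.dist_eq]
    linarith [dist_triangle_right x y c]
  obtain ⟨x₁, hx₁⟩ : P.Nonempty := by rw [← Finset.card_pos, hPc]; omega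
  have hε : 0 ≤ ε := (abs_nonneg _).trans (hPε x₁ hx₁)
  set P' := P.erase x₁ with hP'
  have hPc' : P'.card = j := by rw [hP', Finset.card_erase_of_mem hx₁, hPc]; rfl
  have hsub : ∀ p ∈ P', p ∈ P := fun p hp => Finset.mem_of_mem_erase hp
  have hord : (Metric.closedBall c r).OrdConnected := by
    rw [Real.closedBall_eq_Icc]; exact ordConnected_Icc
  have hI : ∀ x ∈ Metric.closedBall c r,
      |∑ p ∈ P', D 0 p * ∏ q ∈ P'.erase p, (x - q) / (p - q)| ≤ j * ε * (2 / θ) ^ j := by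
    intro x hx
    have := interpolation_bound P' (D 0) ε (2 / θ) x hM (fun p hp => hPε p (hsub p hp)) (by
      intro p hp q hq hne
      have h1 := hsep p (hsub p hp) q (hsub q hq) hne
      refine (hdist x hx q (hPK q (hsub q hq))).trans ?_
      calc 2 * r = 2 / θ * (θ * r) := by field_simp
        _ ≤ _ := by gcongr)
    rwa [hPc'] at this
  have hpw : (1 : ℝ) ≤ (2 / θ) ^ j := one_le_pow₀ hM
  have hfac : (0 : ℝ) < j.factorial := by positivity
  have hfac1 : (1 : ℝ) ≤ j.factorial := by
    exact_mod_cast Nat.one_le_iff_ne_zero.2 (Nat.factorial_ne_zero j)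
  constructor
  · obtain ⟨ξ, hξ, h⟩ := lagrange_error j D _ hord hD P' hPc' (fun p hp => hPK p (hsub p hp)) x₁
      (hPK _ hx₁) (Finset.notMem_erase _ _)
    have h1 : |D j ξ / j.factorial * ∏ p ∈ P', (x₁ - p)| ≤ ε + j * ε * (2 / θ) ^ j := by
      have : D j ξ / j.factorial * ∏ p ∈ P', (x₁ - p) =
        D 0 x₁ - ∑ p ∈ P', D 0 p * ∏ q ∈ P'.erase p, (x₁ - q) / (p - q) := by rw [h]; ring
      rw [this]
      exact (abs_sub _ _).trans (add_le_add (hPε _ hx₁) (hI _ (hPK _ hx₁)))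
    have h2 : (θ * r) ^ j ≤ |∏ p ∈ P', (x₁ - p)| := by
      rw [Finset.abs_prod, ← hPc', ← Finset.prod_const]
      refine Finset.prod_le_prod (fun _ _ => by positivity) fun p hp => ?_
      exact hsep _ hx₁ _ (hsub p hp) (Finset.ne_of_mem_erase hp).symm
    rw [abs_mul, abs_div, Nat.abs_cast] at h1
    have h3 : A₁ * s / j.factorial * (θ * r) ^ j ≤ |D j ξ| / j.factorial * |∏ p ∈ P', (x₁ - p)| := by
      refine mul_le_mul ?_ h2 (by positivity) (by positivity)
      gcongr
      exact hlow ξ hξ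
    have h4 := h3.trans h1
    rw [div_mul_eq_mul_div, div_le_iff₀ hfac] at h4
    refine h4.trans ?_
    rw [mul_comm]
    gcongr
    nlinarith
  · intro hup x hx
    by_cases hxP : x ∈ P'
    · have := hPε x (hsub x hxP)
      have h5 : ε ≤ (j + 1) * ε * (2 / θ) ^ j := by
        calc ε = 1 * ε * 1 := by ring
          _ ≤ _ := by gcongr; linarith [Nat.cast_nonneg (α := ℝ) j]
      have : 0 ≤ A₂ * s * (2 * r) ^ j := by positivity
      linarith
    · obtain ⟨ξ, hξ, h⟩ := lagrange_error j D _ hord hD P' hPc' (fun p hp => hPK p (hsub p hp)) x hx hxP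
      rw [h]
      refine (abs_add_le _ _).trans (add_le_add ((hI x hx).trans ?_) ?_)
      · gcongr; linarith
      · rw [abs_mul, abs_div, Nat.abs_cast]
        refine mul_le_mul ?_ ?_ (abs_nonneg _) (by positivity)
        · rw [div_le_iff₀ hfac]
          have := hup ξ hξ
          have h0 : 0 ≤ A₂ * s := by positivity
          nlinarith
        · rw [Finset.abs_prod, ← hPc', ← Finset.prod_const]
          exact Finset.prod_le_prod (fun _ _ => abs_nonneg _) fun p hp =>
            hdist x hx p (hPK p (hsub p hp))

/-- Functions with a dominating derivative are small only on small sets. -/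
theorem sublevel_small (j : ℕ) (A₁ A₂ η : ℝ) (hA₁ : 0 < A₁) (hA₂ : 0 < A₂) (hη : 0 < η)
    (hη1 : η ≤ 1) :
    ∃ ε : ℝ, 0 < ε ∧ ∀ ε' ≤ ε, ∀ (s c r : ℝ) (D : ℕ → ℝ → ℝ), 0 < r → 0 ≤ s →
      (∀ i < j, ∀ t ∈ Metric.closedBall c r, HasDerivAt (D i) (D (i + 1) t) t) →
      (∀ t ∈ Metric.closedBall c r, A₁ * s ≤ |D j t| ∧ |D j t| ≤ A₂ * s) →
      (∃ x ∈ Metric.closedBall c r, 1 ≤ |D 0 x|) →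
      volume {t ∈ Metric.closedBall c r | |D 0 t| < ε'} ≤ ENNReal.ofReal (η * r) := by
  set θ := η / (2 * (j + 1)) with hθ
  have hθ0 : 0 < θ := by positivity
  have hθ2 : θ ≤ 2 := by
    rw [hθ, div_le_iff₀ (by positivity)]; nlinarith [Nat.cast_nonneg (α := ℝ) j]
  set B := (j + 1) * (2 / θ) ^ j + A₂ * (2 ^ j * (j.factorial * ((j + 1) * (2 / θ) ^ j)) / (A₁ * θ ^ j))
    with hB
  have hB0 : 0 < B := by positivity
  refine ⟨1 / (2 * B), by positivity, ?_⟩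
  intro ε' hε' s c r D hr hs hD hj ⟨x, hx, hx1⟩
  by_contra! hcon
  obtain ⟨P, hPc, hPE, hP⟩ := exists_separated (θ * r) (by positivity) _ j
    (lt_of_le_of_lt (ENNReal.ofReal_le_ofReal (by
      have : θ * (2 * (j + 1)) = η := by rw [hθ]; field_simp
      calc 2 * j * (θ * r) = (θ * (2 * j)) * r := by ring
        _ ≤ (θ * (2 * (j + 1))) * r := by gcongr; linarith
        _ = η * r := by rw [this])) hcon)
  obtain ⟨h1, h2⟩ := nodes_bound j A₁ A₂ s θ (1 / (2 * B)) c r hr hθ0 hθ2 hs hA₂.le D hD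
    (fun t ht => (hj t ht).1) P hPc (fun p hp => (hPE p hp).1) hP
    (fun p hp => ((hPE p hp).2.le).trans hε')
  have h3 := h2 (fun t ht => (hj t ht).2) x hx
  have h4 : s * r ^ j ≤ j.factorial * ((j + 1) * (1 / (2 * B)) * (2 / θ) ^ j) / (A₁ * θ ^ j) := by
    rw [le_div_iff₀ (by positivity)]
    refine le_trans (le_of_eq ?_) h1
    rw [mul_pow]; ring
  have h5 : A₂ * s * (2 * r) ^ j ≤ A₂ * 2 ^ j *
      (j.factorial * ((j + 1) * (1 / (2 * B)) * (2 / θ) ^ j) / (A₁ * θ ^ j)) := by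
    refine le_trans (le_of_eq ?_) (mul_le_mul_of_nonneg_left h4 (by positivity))
    rw [mul_pow]; ring
  have h6 : (j + 1) * (1 / (2 * B)) * (2 / θ) ^ j + A₂ * 2 ^ j *
      (j.factorial * ((j + 1) * (1 / (2 * B)) * (2 / θ) ^ j) / (A₁ * θ ^ j)) = 1 / 2 := by
    have : (j + 1) * (1 / (2 * B)) * (2 / θ) ^ j + A₂ * 2 ^ j *
      (j.factorial * ((j + 1) * (1 / (2 * B)) * (2 / θ) ^ j) / (A₁ * θ ^ j)) = 1 / (2 * B) * B := by
      rw [hB]; ring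
    rw [this]; field_simp
  linarith

/-- Functions with a large derivative cannot be uniformly small. -/
theorem exists_large_value (j : ℕ) (A₁ r : ℝ) (hA₁ : 0 < A₁) (hr : 0 < r) :
    ∃ ε : ℝ, 0 < ε ∧ ∀ (c : ℝ) (D : ℕ → ℝ → ℝ),
      (∀ i < j, ∀ t ∈ Metric.closedBall c r, HasDerivAt (D i) (D (i + 1) t) t) →
      (∀ t ∈ Metric.closedBall c r, A₁ ≤ |D j t|) →
      ∃ x ∈ Metric.closedBall c r, ε ≤ |D 0 x| := by
  set θ : ℝ := 1 / (j + 1) with hθ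
  have hθ0 : 0 < θ := by positivity
  have hθ1 : θ ≤ 1 := by
    rw [hθ, div_le_iff₀ (by positivity)]; linarith [Nat.cast_nonneg (α := ℝ) j]
  set B := (j.factorial * ((j + 1) * (2 / θ) ^ j)) with hB
  have hB0 : 0 < B := by positivity
  refine ⟨A₁ * (θ * r) ^ j / (2 * B), by positivity, ?_⟩
  intro c D hD hj
  by_contra! hcon
  obtain ⟨P, hPc, hPE, hP⟩ := exists_separated (θ * r) (by positivity) (Metric.closedBall c r) j
    (by
      rw [Real.volume_closedBall, ENNReal.ofReal_lt_ofReal_iff (by positivity)]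
      have : θ * (j + 1) = 1 := by rw [hθ]; field_simp
      nlinarith)
  obtain ⟨h1, -⟩ := nodes_bound j A₁ 1 1 θ (A₁ * (θ * r) ^ j / (2 * B)) c r hr hθ0 (by linarith)
    zero_le_one zero_le_one D hD
    (fun t ht => by rw [mul_one]; exact hj t ht) P hPc hPE hP
    (fun p hp => (hcon p (hPE p hp)).le)
  have : j.factorial * ((j + 1) * (A₁ * (θ * r) ^ j / (2 * B)) * (2 / θ) ^ j) =
      A₁ * (θ * r) ^ j / (2 * B) * B := by rw [hB]; ring
  rw [this] at h1
  have h2 : A₁ * (θ * r) ^ j / (2 * B) * B = A₁ * (θ * r) ^ j / 2 := by field_simp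
  have : 0 < A₁ * (θ * r) ^ j := by positivity
  linarith

theorem besicovitch_measure_bound : ∃ N : ℕ, ∀ (E G : Set ℝ) (ρ : ℝ → ℝ) (κ x₀ R : ℝ), 0 ≤ κ →
    0 ≤ R →
    (∀ x ∈ E, 0 < ρ x ∧ Metric.closedBall x (ρ x) ⊆ Metric.closedBall x₀ R ∧
      volume (Metric.ball x (ρ x) \ G) ≤ ENNReal.ofReal (κ * ρ x)) →
    volume (E \ G) ≤ ENNReal.ofReal (N * (κ * R)) := by
  obtain ⟨N, τ, hτ, hN⟩ := HasBesicovitchCovering.no_satelliteConfig (α := ℝ)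
  refine ⟨N, fun E G ρ κ x₀ R hκ hR h => ?_⟩
  let q : Besicovitch.BallPackage E ℝ :=
    { c := fun x => x
      r := fun x => ρ x
      rpos := fun x => (h x x.2).1
      r_bound := R
      r_le := fun x => by
        have := (h x x.2).2.1
        have hv := measure_mono (μ := volume) this
        rw [Real.volume_closedBall, Real.volume_closedBall,
          ENNReal.ofReal_le_ofReal_iff (by positivity)] at hv
        linarith }
  obtain ⟨s, hs, hcov⟩ := Besicovitch.exist_disjoint_covering_families hτ hN q
  have hcount : ∀ i, (s i).Countable := fun i =>
    (hs i).countable_of_nonempty_interior fun j _ => by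
      have h0 : 0 < q.r j := q.rpos j
      rw [interior_closedBall _ h0.ne']
      exact ⟨_, Metric.mem_ball_self h0⟩
  have hsub : E \ G ⊆ ⋃ i : Fin N, ⋃ j ∈ s i, (Metric.ball (q.c j) (q.r j) \ G) := by
    intro x hx
    have : x ∈ range q.c := ⟨⟨x, hx.1⟩, rfl⟩
    have := hcov this
    simp only [mem_iUnion] at this ⊢
    obtain ⟨i, j, hj, hxj⟩ := this
    exact ⟨i, j, hj, hxj, hx.2⟩
  have hi : ∀ i : Fin N, volume (⋃ j ∈ s i, (Metric.ball (q.c j) (q.r j) \ G)) ≤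
      ENNReal.ofReal (κ * R) := by
    intro i
    calc volume (⋃ j ∈ s i, (Metric.ball (q.c j) (q.r j) \ G))
        ≤ ∑' j : s i, volume (Metric.ball (q.c j) (q.r j) \ G) := measure_biUnion_le _ (hcount i) _
      _ ≤ ∑' j : s i, ENNReal.ofReal (κ / 2) * volume (Metric.closedBall (q.c j) (q.r j)) := by
          refine ENNReal.tsum_le_tsum fun j => ?_
          rw [Real.volume_closedBall, ← ENNReal.ofReal_mul (by positivity)]
          refine ((h _ (j : E).2).2.2).trans (ENNReal.ofReal_le_ofReal (le_of_eq ?_))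
          change κ * ρ _ = κ / 2 * (2 * ρ _)
          ring
      _ = ENNReal.ofReal (κ / 2) * volume (⋃ j ∈ s i, Metric.closedBall (q.c j) (q.r j)) := by
          rw [ENNReal.tsum_mul_left, measure_biUnion (hcount i) (hs i)
            fun j _ => measurableSet_closedBall]
      _ ≤ ENNReal.ofReal (κ / 2) * volume (Metric.closedBall x₀ R) := by
          gcongr
          exact iUnion₂_subset fun j _ => (h j j.2).2.1
      _ = ENNReal.ofReal (κ * R) := by
          rw [Real.volume_closedBall, ← ENNReal.ofReal_mul (by positivity)]
          congr 1; ring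
  calc volume (E \ G) ≤ ∑ i : Fin N, volume (⋃ j ∈ s i, (Metric.ball (q.c j) (q.r j) \ G)) :=
        (measure_mono hsub).trans (measure_iUnion_fintype_le _ _)
    _ ≤ ∑ _i : Fin N, ENNReal.ofReal (κ * R) := Finset.sum_le_sum fun i _ => hi i
    _ = ENNReal.ofReal (N * (κ * R)) := by
        rw [Finset.sum_const, Finset.card_univ, Fintype.card_fin, nsmul_eq_mul,
          ENNReal.ofReal_mul (Nat.cast_nonneg N), ENNReal.ofReal_natCast]

/-- A point is marked if a chain of indices certifies that it avoids the cusp. -/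
def Marked {ι : Type*} [PartialOrder ι] (ψ : ι → ℝ → ℝ) (ε : ℝ) (S : Finset ι) (x : ℝ) : Prop :=
  ∃ F ⊆ S, IsChain (· ≤ ·) (F : Set ι) ∧ (∀ Γ ∈ F, ε ≤ ψ Γ x ∧ ψ Γ x ≤ 1) ∧
    ∀ Γ ∈ S, Γ ∉ F → (∀ Γ' ∈ F, Γ ≤ Γ' ∨ Γ' ≤ Γ) → 1 ≤ ψ Γ x

/-- Quantitative nondivergence on the line. -/
theorem quantitative_nondivergence (k : ℕ) : ∃ C : ℝ, 0 ≤ C ∧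
    ∀ {ι : Type} [PartialOrder ι] [Nonempty ι] (ψ : ι → ℝ → ℝ) (U : Set ℝ) (ε η : ℝ), 0 ≤ η →
    (∀ Γ, ContinuousOn (ψ Γ) U) →
    (∀ Γ c r, 0 < r → Metric.closedBall c r ⊆ U → (∃ y ∈ Metric.closedBall c r, 1 ≤ ψ Γ y) →
      volume {y ∈ Metric.closedBall c r | ψ Γ y < ε} ≤ ENNReal.ofReal (η * r)) →
    ∀ (S : Finset ι), (∀ F ⊆ S, IsChain (· ≤ ·) (F : Set ι) → F.card ≤ k) →
    ∀ x₀ r₀ : ℝ, 0 < r₀ → Metric.closedBall x₀ (3 ^ k * r₀) ⊆ U →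
    (∀ Γ ∈ S, ∃ y ∈ Metric.closedBall x₀ r₀, 1 ≤ ψ Γ y) →
    volume (Metric.closedBall x₀ r₀ \ {y | Marked ψ ε S y}) ≤ ENNReal.ofReal (C * η * r₀) := by
  classical
  induction k with
  | zero =>
    refine ⟨0, le_rfl, ?_⟩
    intro ι _ _ ψ U ε η _ _ _ S hS x₀ r₀ _ _ _
    have hS0 : S = ∅ := by
      by_contra hne
      obtain ⟨Γ, hΓ⟩ := Finset.nonempty_iff_ne_empty.2 hne
      have := hS {Γ} (by simpa using hΓ) (by simp)
      simp at this
    have : Metric.closedBall x₀ r₀ \ {y | Marked ψ ε S y} = ∅ := by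
      rw [sdiff_eq_empty]
      intro y _
      exact ⟨∅, by simp, by simp, by simp, by simp [hS0]⟩
    simp [this]
  | succ k ih =>
    obtain ⟨C, hC, ih⟩ := ih
    obtain ⟨N, hN⟩ := besicovitch_measure_bound
    refine ⟨N * ((C + 1) * 3), by positivity, ?_⟩
    intro ι _ _ ψ U ε η hη hcont hgood S hS x₀ r₀ hr₀ hU hlarge
    have h3k : (1 : ℝ) ≤ 3 ^ k := one_le_pow₀ (by norm_num)
    have hU3 : Metric.closedBall x₀ (3 * r₀) ⊆ U := by
      refine (Metric.closedBall_subset_closedBall ?_).trans hU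
      rw [pow_succ]; nlinarith
    set D : ι → Set ℝ := fun Γ => {y ∈ Metric.closedBall x₀ (3 * r₀) | 1 ≤ ψ Γ y} with hDdef
    have hDclosed : ∀ Γ, IsClosed (D Γ) := fun Γ => by
      have := ((hcont Γ).mono hU3).preimage_isClosed_of_isClosed Metric.isClosed_closedBall
        (isClosed_Ici (a := (1 : ℝ)))
      exact this
    have hr3 : Metric.closedBall x₀ r₀ ⊆ Metric.closedBall x₀ (3 * r₀) :=
      Metric.closedBall_subset_closedBall (by linarith)
    have hDle : ∀ Γ ∈ S, ∀ x ∈ Metric.closedBall x₀ r₀, Metric.infDist x (D Γ) ≤ 2 * r₀ := by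
      intro Γ hΓ x hx
      obtain ⟨y, hy, hy1⟩ := hlarge Γ hΓ
      refine (Metric.infDist_le_dist_of_mem (show y ∈ D Γ from ⟨hr3 hy, hy1⟩)).trans ?_
      rw [Metric.mem_closedBall] at hx hy
      linarith [dist_triangle_right x y x₀]
    have hDne : ∀ Γ ∈ S, (D Γ).Nonempty := by
      intro Γ hΓ
      obtain ⟨y, hy, hy1⟩ := hlarge Γ hΓ
      exact ⟨y, hr3 hy, hy1⟩
    set E : Set ℝ := {x ∈ Metric.closedBall x₀ r₀ | ∃ Γ ∈ S, ψ Γ x < 1} with hE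
    have hmax : ∀ x ∈ E, ∃ Γ ∈ S, ψ Γ x < 1 ∧
        ∀ Γ' ∈ S, Metric.infDist x (D Γ') ≤ Metric.infDist x (D Γ) := by
      rintro x ⟨hx, Γ₀, hΓ₀, hlt⟩
      obtain ⟨Γ, hΓ, hmaxΓ⟩ := S.exists_max_image (fun Γ => Metric.infDist x (D Γ)) ⟨Γ₀, hΓ₀⟩
      refine ⟨Γ, hΓ, ?_, hmaxΓ⟩
      by_contra hge
      have h0 : Metric.infDist x (D Γ) = 0 :=
        Metric.infDist_zero_of_mem ⟨hr3 hx, not_lt.1 hge⟩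
      have h1 := hmaxΓ Γ₀ hΓ₀
      have h2 : 0 < Metric.infDist x (D Γ₀) :=
        ((hDclosed Γ₀).notMem_iff_infDist_pos (hDne Γ₀ hΓ₀)).1 fun hmem => absurd hmem.2 (not_le.2 hlt)
      linarith
    choose! Γm hΓS hΓlt hΓmax using hmax
    have hmain := hN E {y | Marked ψ ε S y} (fun x => Metric.infDist x (D (Γm x))) ((C + 1) * η) x₀
      (3 * r₀) (by positivity) (by positivity) (by
      intro x hx
      have hxB : x ∈ Metric.closedBall x₀ r₀ := hx.1
      set Γ := Γm x with hΓdef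
      set r := Metric.infDist x (D Γ) with hr
      have hrpos : 0 < r := ((hDclosed Γ).notMem_iff_infDist_pos (hDne Γ (hΓS x hx))).1
        fun hmem => absurd hmem.2 (not_le.2 (hΓlt x hx))
      have hr2 : r ≤ 2 * r₀ := hDle Γ (hΓS x hx) x hxB
      have hball : ∀ a : ℝ, a ≤ 3 ^ k → 0 ≤ a →
          Metric.closedBall x (a * r) ⊆ Metric.closedBall x₀ ((1 + 2 * a) * r₀) := by
        intro a ha ha0
        refine Metric.closedBall_subset_closedBall' ?_
        rw [Metric.mem_closedBall] at hxB
        nlinarith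
      have hball3 : Metric.closedBall x r ⊆ Metric.closedBall x₀ (3 * r₀) := by
        have := hball 1 h3k zero_le_one
        rwa [one_mul, show (1 : ℝ) + 2 * 1 = 3 by norm_num] at this
      have hballk : Metric.closedBall x (3 ^ k * r) ⊆ U := by
        refine ((hball (3 ^ k) le_rfl (by positivity)).trans
          (Metric.closedBall_subset_closedBall ?_)).trans hU
        rw [pow_succ]; nlinarith
      have hlarge' : ∀ Γ' ∈ S, ∃ y ∈ Metric.closedBall x r, 1 ≤ ψ Γ' y := by
        intro Γ' hΓ'
        obtain ⟨y, hy, hyd⟩ := (hDclosed Γ').exists_infDist_eq_dist (hDne Γ' hΓ') x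
        refine ⟨y, ?_, hy.2⟩
        rw [Metric.mem_closedBall, dist_comm, ← hyd]
        exact hΓmax x hx Γ' hΓ'
      refine ⟨hrpos, hball3, ?_⟩
      set S' := S.filter fun Γ' => Γ' ≠ Γ ∧ (Γ' ≤ Γ ∨ Γ ≤ Γ') with hS'
      have hS'sub : S' ⊆ S := Finset.filter_subset _ _
      have hIH := ih ψ U ε η hη hcont hgood S' (by
        intro F hF hch
        have hΓF : Γ ∉ F := fun hmem => (Finset.mem_filter.1 (hF hmem)).2.1 rfl
        have := hS (insert Γ F) (by
          intro Γ' h'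
          rcases Finset.mem_insert.1 h' with rfl | h'
          · exact hΓS x hx
          · exact hS'sub (hF h')) (by
          rw [Finset.coe_insert]
          refine hch.insert fun Γ' h' _ => ?_
          exact (Finset.mem_filter.1 (hF h')).2.2.symm)
        rw [Finset.card_insert_of_notMem hΓF] at this
        omega) x r hrpos hballk (fun Γ' h' => hlarge' Γ' (hS'sub h'))
      have hg := hgood Γ x r hrpos (hball3.trans hU3) (hlarge' Γ (hΓS x hx))
      have hsub : Metric.ball x r \ {y | Marked ψ ε S y} ⊆
          (Metric.closedBall x r \ {y | Marked ψ ε S' y}) ∪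
            {y ∈ Metric.closedBall x r | ψ Γ y < ε} := by
        rintro z ⟨hz, hzM⟩
        have hzc := Metric.ball_subset_closedBall hz
        by_cases hzε : ψ Γ z < ε
        · exact Or.inr ⟨hzc, hzε⟩
        refine Or.inl ⟨hzc, fun hzM' => hzM ?_⟩
        obtain ⟨F, hFS, hch, hF1, hF2⟩ := hzM'
        have hz1 : ψ Γ z < 1 := by
          by_contra hge
          have : z ∈ D Γ := ⟨hball3 hzc, not_lt.1 hge⟩
          have := Metric.infDist_le_dist_of_mem (x := x) this
          rw [Metric.mem_ball, dist_comm] at hz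
          linarith
        refine ⟨insert Γ F, ?_, ?_, ?_, ?_⟩
        · intro Γ' h'
          rcases Finset.mem_insert.1 h' with rfl | h'
          · exact hΓS x hx
          · exact hS'sub (hFS h')
        · rw [Finset.coe_insert]
          exact hch.insert fun Γ' h' _ => (Finset.mem_filter.1 (hFS h')).2.2.symm
        · intro Γ' h'
          rcases Finset.mem_insert.1 h' with rfl | h'
          · exact ⟨not_lt.1 hzε, hz1.le⟩
          · exact hF1 Γ' h'
        · intro Γ' hΓ' hnot hcomp
          rw [Finset.mem_insert, not_or] at hnot
          refine hF2 Γ' (Finset.mem_filter.2 ⟨hΓ', hnot.1, hcomp Γ (Finset.mem_insert_self _ _)⟩)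
            hnot.2 fun Γ'' h'' => hcomp Γ'' (Finset.mem_insert_of_mem h'')
      refine (measure_mono hsub).trans ((measure_union_le _ _).trans ((add_le_add hIH hg).trans ?_))
      rw [← ENNReal.ofReal_add (by positivity) (by positivity)]
      exact ENNReal.ofReal_le_ofReal (le_of_eq (by ring)))
    refine (measure_mono ?_).trans (hmain.trans (ENNReal.ofReal_le_ofReal (le_of_eq (by ring))))
    rintro y ⟨hy, hyM⟩
    refine ⟨⟨hy, ?_⟩, hyM⟩
    by_contra! hcon
    exact hyM ⟨∅, by simp, by simp, by simp, fun Γ hΓ _ _ => hcon Γ hΓ⟩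

/-- The integer minor of a tuple of integer vectors given by a choice of columns. -/
def intMinor {j d : ℕ} (u : Fin j → Fin d → ℤ) (I : Fin j → Fin d) : ℤ :=
  (Matrix.of fun a b => u a (I b)).det

/-- The minor of the image of a tuple of integer vectors under a real matrix. -/
noncomputable def realMinor {j d : ℕ} (M : Matrix (Fin d) (Fin d) ℝ) (u : Fin j → Fin d → ℤ)
    (I : Fin j → Fin d) : ℝ :=
  (Matrix.of fun a b => M.mulVec (fun k => (u a k : ℝ)) (I b)).det

/-- The supremum norm of the wedge product of the image of a tuple under a real matrix. -/
noncomputable def wedgeNorm {j d : ℕ} (M : Matrix (Fin d) (Fin d) ℝ) (u : Fin j → Fin d → ℤ) : ℝ :=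
  ‖fun I : Fin j → Fin d => realMinor M u I‖

theorem abs_realMinor_le {j d : ℕ} (M : Matrix (Fin d) (Fin d) ℝ) (u : Fin j → Fin d → ℤ)
    (I : Fin j → Fin d) : |realMinor M u I| ≤ wedgeNorm M u :=
  norm_le_pi_norm (fun I : Fin j → Fin d => realMinor M u I) I

theorem wedgeNorm_nonneg {j d : ℕ} (M : Matrix (Fin d) (Fin d) ℝ) (u : Fin j → Fin d → ℤ) :
    0 ≤ wedgeNorm M u := norm_nonneg _

theorem wedgeNorm_cons_le {j d : ℕ} (M : Matrix (Fin d) (Fin d) ℝ) (u : Fin j → Fin d → ℤ)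
    (v : Fin d → ℤ) :
    wedgeNorm M (Fin.cons v u : Fin (j + 1) → Fin d → ℤ) ≤
      (j + 1) * ‖M.mulVec fun k => (v k : ℝ)‖ * wedgeNorm M u := by
  have hw := wedgeNorm_nonneg M u
  refine (pi_norm_le_iff_of_nonneg (by positivity)).2 fun I => ?_
  rw [Real.norm_eq_abs, realMinor, Matrix.det_succ_row_zero]
  refine (Finset.abs_sum_le_sum_abs _ _).trans ?_
  refine (Finset.sum_le_card_nsmul _ _ (‖M.mulVec fun k => (v k : ℝ)‖ * wedgeNorm M u) ?_).trans ?_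
  · intro b _
    rw [abs_mul, abs_mul, abs_pow, abs_neg, abs_one, one_pow, one_mul]
    refine mul_le_mul ?_ ?_ (abs_nonneg _) (norm_nonneg _)
    · simpa using norm_le_pi_norm (M.mulVec fun k => (v k : ℝ)) (I b)
    · refine le_of_eq_of_le (congrArg abs ?_)
        (abs_realMinor_le M u fun b' => I (b.succAbove b'))
      rw [realMinor]
      congr 1
  · rw [Finset.card_univ, Fintype.card_fin, nsmul_eq_mul]
    push_cast
    rw [mul_assoc]

theorem cast_intMinor {R : Type*} [CommRing R] {j d : ℕ} (u : Fin j → Fin d → ℤ)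
    (I : Fin j → Fin d) :
    (intMinor u I : R) = (Matrix.of fun a b => (u a (I b) : R)).det :=
  RingHom.map_det (Int.castRingHom R) _

theorem intMinor_transform {j d : ℕ} (u u' : Fin j → Fin d → ℤ) (A : Matrix (Fin j) (Fin j) ℚ)
    (h : ∀ a k, (u' a k : ℚ) = ∑ b, A a b * u b k) (I : Fin j → Fin d) :
    (intMinor u' I : ℚ) = A.det * intMinor u I := by
  rw [cast_intMinor, cast_intMinor, ← Matrix.det_mul]
  congr 1
  ext a b
  simp [Matrix.mul_apply, h]

theorem wedgeNorm_transform {j d : ℕ} (M : Matrix (Fin d) (Fin d) ℝ) (u u' : Fin j → Fin d → ℤ)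
    (A : Matrix (Fin j) (Fin j) ℚ)
    (h : ∀ a k, (u' a k : ℚ) = ∑ b, A a b * u b k) :
    wedgeNorm M u' = |(A.det : ℝ)| * wedgeNorm M u := by
  have key : ∀ I : Fin j → Fin d, realMinor M u' I = (A.det : ℝ) * realMinor M u I := by
    intro I
    have hA : (A.det : ℝ) = (A.map (Rat.castHom ℝ)).det := by
      rw [← Rat.coe_castHom, RingHom.map_det]; rfl
    rw [hA, realMinor, realMinor, ← Matrix.det_mul]
    congr 1
    ext a b
    have h' : ∀ k, (u' a k : ℝ) = ∑ b, (A a b : ℝ) * u b k := by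
      intro k
      have := h a k
      exact_mod_cast congrArg (fun t : ℚ => (t : ℝ)) this
    simp only [Matrix.of_apply, Matrix.mul_apply, Matrix.mulVec, dotProduct, Matrix.map_apply, h',
      Finset.mul_sum, Rat.coe_castHom]
    rw [Finset.sum_comm]
    refine Finset.sum_congr rfl fun c _ => Finset.sum_congr rfl fun k _ => ?_
    ring
  have : (fun I : Fin j → Fin d => realMinor M u' I) =
      (A.det : ℝ) • fun I : Fin j → Fin d => realMinor M u I := by
    ext I; simp [key]
  rw [wedgeNorm, this, norm_smul, Real.norm_eq_abs, wedgeNorm]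

/-- Independent rows have a nonzero maximal minor. -/
theorem exists_intMinor_ne_zero {j d : ℕ} (u : Fin j → Fin d → ℤ)
    (hu : LinearIndependent ℚ fun a => (fun k => (u a k : ℚ))) :
    ∃ I : Fin j → Fin d, intMinor u I ≠ 0 := by
  set U : Matrix (Fin j) (Fin d) ℚ := Matrix.of fun a k => (u a k : ℚ) with hU
  have hrank : U.rank = j := by
    have : LinearIndependent ℚ U.row := hu
    simpa using this.rank_matrix
  rw [Matrix.rank_eq_finrank_span_cols] at hrank
  obtain ⟨f, hf, -, hfi⟩ := Submodule.exists_fun_fin_finrank_span_eq ℚ (Set.range U.col)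
  choose I hI using hf
  refine ⟨fun b => I (Fin.cast hrank.symm b), fun h0 => ?_⟩
  have hfi' := hfi.comp (Fin.cast hrank.symm) (Fin.cast_injective _)
  have : LinearIndependent ℚ (Matrix.of fun a b : Fin j => (u a (I (Fin.cast hrank.symm b)) : ℚ)).col := by
    have hcol : (Matrix.of fun a b : Fin j => (u a (I (Fin.cast hrank.symm b)) : ℚ)).col =
        f ∘ Fin.cast hrank.symm := by
      ext b a
      rw [Function.comp_apply, ← hI]
      rfl
    rw [hcol]
    exact hfi'
  rw [Matrix.linearIndependent_cols_iff_isUnit, Matrix.isUnit_iff_isUnit_det] at this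
  apply this.ne_zero
  have h1 := congrArg (Int.castRingHom ℚ) h0
  rw [intMinor, RingHom.map_det, map_zero] at h1
  exact h1

theorem intMinor_eq_zero {j d : ℕ} (u : Fin j → Fin d → ℤ) (I : Fin j → Fin d) {b b' : Fin j}
    (hb : b ≠ b') (h : I b = I b') : intMinor u I = 0 :=
  Matrix.det_zero_of_column_eq hb fun a => by simp [h]

/-- The matrix of the diagonal flow composed with the unipotent element of the curve. -/
noncomputable def flowMatrix (n : ℕ) (q : ℝ) (g : Fin (n + 1) → ℝ) :
    Matrix (Fin (n + 1)) (Fin (n + 1)) ℝ :=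
  Matrix.of (Fin.cons (fun k => q ^ n * g k) fun i k => if k = i.succ then q⁻¹ else 0)

theorem flowMatrix_mulVec_zero (n : ℕ) (q : ℝ) (g v : Fin (n + 1) → ℝ) :
    (flowMatrix n q g).mulVec v 0 = q ^ n * ∑ k, v k * g k := by
  simp only [Matrix.mulVec, dotProduct, flowMatrix, Matrix.of_apply, Fin.cons_zero, Finset.mul_sum]
  exact Finset.sum_congr rfl fun k _ => by ring

theorem flowMatrix_mulVec_succ (n : ℕ) (q : ℝ) (g v : Fin (n + 1) → ℝ) (i : Fin n) :
    (flowMatrix n q g).mulVec v i.succ = q⁻¹ * v i.succ := by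
  simp [Matrix.mulVec, dotProduct, flowMatrix]

theorem flowMatrix_mulVec_ne_zero (n : ℕ) (q : ℝ) (g v : Fin (n + 1) → ℝ) (i : Fin (n + 1))
    (hi : i ≠ 0) : (flowMatrix n q g).mulVec v i = q⁻¹ * v i := by
  obtain ⟨k, rfl⟩ := Fin.exists_succ_eq.2 hi
  exact flowMatrix_mulVec_succ n q g v k

theorem flowMatrix_det (n : ℕ) (q : ℝ) (hq : q ≠ 0) (g : Fin (n + 1) → ℝ) (hg : g 0 = 1) :
    (flowMatrix n q g).det = 1 := by
  rw [Matrix.det_of_isUpperTriangular]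
  · rw [Fin.prod_univ_succ]
    simp [flowMatrix, hg, hq]
  · intro i k hik
    simp only [id] at hik
    obtain ⟨i', rfl⟩ := Fin.exists_succ_eq.2 (Fin.ne_zero_of_lt hik)
    simp [flowMatrix, hik.ne]

theorem realMinor_flow_of_ne_zero {j n : ℕ} (q : ℝ) (g : Fin (n + 1) → ℝ)
    (u : Fin j → Fin (n + 1) → ℤ) (I : Fin j → Fin (n + 1)) (hI : ∀ b, I b ≠ 0) :
    realMinor (flowMatrix n q g) u I = q⁻¹ ^ j * intMinor u I := by
  rw [cast_intMinor, realMinor]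
  have := Matrix.det_mul_row (fun _ : Fin j => q⁻¹) (Matrix.of fun a b => (u a (I b) : ℝ))
  rw [Finset.prod_const, Finset.card_univ, Fintype.card_fin] at this
  rw [← this]
  congr 1
  ext a b
  simp only [Matrix.of_apply]
  rw [flowMatrix_mulVec_ne_zero _ _ _ _ _ (hI b)]

theorem realMinor_flow_of_eq_zero {j n : ℕ} (q : ℝ) (g : Fin (n + 1) → ℝ)
    (u : Fin j → Fin (n + 1) → ℤ) (I : Fin j → Fin (n + 1)) (b : Fin j) (hb : I b = 0)
    (hI : ∀ b' ≠ b, I b' ≠ 0) :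
    realMinor (flowMatrix n q g) u I =
      q ^ n * q⁻¹ ^ (j - 1) * ∑ k, (intMinor u (Function.update I b k) : ℝ) * g k := by
  classical
  set N : Matrix (Fin j) (Fin j) ℝ := Matrix.of fun a b => (u a (I b) : ℝ) with hN
  let φ : (Fin j → ℝ) →ₗ[ℝ] ℝ :=
    { toFun := fun w => (N.updateCol b w).det
      map_add' := fun w w' => Matrix.det_updateCol_add N b w w'
      map_smul' := fun s w => Matrix.det_updateCol_smul N b s w }
  have h2 : ∀ k, (intMinor u (Function.update I b k) : ℝ) = φ (fun a => (u a k : ℝ)) := by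
    intro k
    rw [cast_intMinor]
    change _ = (N.updateCol b _).det
    congr 1
    ext a b'
    rw [Matrix.updateCol_apply, Matrix.of_apply]
    by_cases hbb : b' = b
    · subst hbb; simp
    · simp [hbb, hN]
  have h3 : ∑ k, (intMinor u (Function.update I b k) : ℝ) * g k =
      φ (∑ k, g k • fun a => (u a k : ℝ)) := by
    rw [map_sum]
    refine Finset.sum_congr rfl fun k _ => ?_
    rw [h2, map_smul, smul_eq_mul, mul_comm]
  have h4 := Matrix.det_mul_row (fun b' : Fin j => if b' = b then q ^ n else q⁻¹)
    (N.updateCol b (∑ k, g k • fun a => (u a k : ℝ)))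
  have h5 : (∏ b' : Fin j, if b' = b then q ^ n else q⁻¹) = q ^ n * q⁻¹ ^ (j - 1) := by
    rw [← Finset.mul_prod_erase _ _ (Finset.mem_univ b), if_pos rfl,
      Finset.prod_congr rfl (g := fun _ => q⁻¹) fun b' hb' => if_neg (Finset.ne_of_mem_erase hb'),
      Finset.prod_const, Finset.card_erase_of_mem (Finset.mem_univ b), Finset.card_univ,
      Fintype.card_fin]
  rw [h3, ← h5]
  refine Eq.trans ?_ h4
  rw [realMinor]
  congr 1
  ext a b'
  simp only [Matrix.of_apply, Matrix.updateCol_apply]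
  by_cases hbb : b' = b
  · subst hbb
    rw [hb, flowMatrix_mulVec_zero]
    simp [Finset.sum_apply, mul_comm]
  · rw [if_neg hbb, if_neg hbb, flowMatrix_mulVec_ne_zero _ _ _ _ _ (hI _ hbb)]
    simp [hN]

theorem realMinor_flow_eq_sum {j n : ℕ} (q : ℝ) (u : Fin j → Fin (n + 1) → ℤ)
    (I : Fin j → Fin (n + 1)) :
    ∃ c : Fin (n + 1) → ℝ, ∀ g : Fin (n + 1) → ℝ, g 0 = 1 →
      realMinor (flowMatrix n q g) u I = ∑ k, c k * g k := by
  classical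
  by_cases h0 : ∃ b, I b = 0
  · obtain ⟨b, hb⟩ := h0
    by_cases h1 : ∀ b' ≠ b, I b' ≠ 0
    · refine ⟨fun k => q ^ n * q⁻¹ ^ (j - 1) * intMinor u (Function.update I b k), fun g _ => ?_⟩
      rw [realMinor_flow_of_eq_zero q g u I b hb h1, Finset.mul_sum]
      exact Finset.sum_congr rfl fun k _ => by ring
    · push Not at h1
      obtain ⟨b', hne, hb'⟩ := h1
      refine ⟨0, fun g _ => ?_⟩
      simp only [Pi.zero_apply, zero_mul, Finset.sum_const_zero]
      exact Matrix.det_zero_of_column_eq hne fun a => by simp [hb, hb']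
  · push Not at h0
    refine ⟨fun k => if k = 0 then q⁻¹ ^ j * intMinor u I else 0, fun g hg => ?_⟩
    rw [realMinor_flow_of_ne_zero q g u I h0]
    simp [hg]

theorem wedgeNorm_flow_lower {j n : ℕ} (hj : 1 ≤ j) (u : Fin j → Fin (n + 1) → ℤ)
    (hu : LinearIndependent ℚ fun a => (fun k => (u a k : ℚ))) :
    (∃ m : Fin (n + 1) → ℤ, m ≠ 0 ∧ ∀ (q : ℝ) (g : Fin (n + 1) → ℝ), 1 ≤ q →
      q * |∑ k, m k * g k| ≤ wedgeNorm (flowMatrix n q g) u) ∨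
    ∀ (q : ℝ) (g : Fin (n + 1) → ℝ), 1 ≤ q → g 0 = 1 → 1 ≤ wedgeNorm (flowMatrix n q g) u := by
  classical
  obtain ⟨I, hI⟩ := exists_intMinor_ne_zero u hu
  have hinj : Function.Injective I := by
    intro b b' h
    by_contra hne
    exact hI (intMinor_eq_zero u I hne h)
  obtain ⟨b, hb⟩ : ∃ b, ∀ b' ≠ b, I b' ≠ 0 := by
    by_cases h0 : ∃ b, I b = 0
    · obtain ⟨b, hb⟩ := h0
      exact ⟨b, fun b' hne h => hne (hinj (h.trans hb.symm))⟩
    · push Not at h0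
      exact ⟨⟨0, hj⟩, fun b' _ => h0 b'⟩
  set I' := Function.update I b 0 with hI'
  have hform : ∀ (q : ℝ) (g : Fin (n + 1) → ℝ), realMinor (flowMatrix n q g) u I' =
      q ^ n * q⁻¹ ^ (j - 1) * ∑ k, (intMinor u (Function.update I b k) : ℝ) * g k := by
    intro q g
    rw [realMinor_flow_of_eq_zero q g u I' b (by simp [hI'])
      (fun b' hne => by rw [hI', Function.update_of_ne hne]; exact hb b' hne)]
    simp [hI']
  have hm : intMinor u (Function.update I b (I b)) ≠ 0 := by rwa [Function.update_eq_self]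
  have hle : j ≤ n + 1 := by simpa using Fintype.card_le_of_injective I hinj
  rcases hle.lt_or_eq with hlt | heq
  · left
    refine ⟨fun k => intMinor u (Function.update I b k), fun h => hm (congrFun h (I b)), ?_⟩
    intro q g hq
    refine le_trans ?_ (abs_realMinor_le _ _ I')
    rw [hform, abs_mul]
    gcongr
    have hq0 : 0 < q := by linarith
    rw [abs_of_nonneg (by positivity), inv_pow, ← div_eq_mul_inv, le_div_iff₀ (by positivity),
      ← pow_succ']
    exact pow_le_pow_right₀ hq (by omega)
  · right
    have hsurj : Function.Surjective I := by
      have : Fintype.card (Fin j) = Fintype.card (Fin (n + 1)) := by simp [heq]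
      exact ((Fintype.bijective_iff_injective_and_card I).2 ⟨hinj, this⟩).2
    obtain ⟨b₀, hb₀⟩ := hsurj 0
    have hbb : b₀ = b := by
      by_contra hne; exact hb b₀ hne hb₀
    subst hbb
    intro q g hq hg
    refine le_trans ?_ (abs_realMinor_le _ _ I')
    have hq0 : 0 < q := by linarith
    rw [hform, Finset.sum_eq_single 0, hg, mul_one, abs_mul]
    · have : q ^ n * q⁻¹ ^ (j - 1) = 1 := by
        rw [heq, Nat.add_sub_cancel, ← mul_pow, mul_inv_cancel₀ hq0.ne', one_pow]
      rw [this, abs_one, one_mul]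
      rw [hb₀] at hm
      exact_mod_cast Int.one_le_abs hm
    · intro k _ hk
      obtain ⟨b', hb'⟩ := hsurj k
      have hne : b' ≠ b₀ := by
        rintro rfl; exact hk (hb'.symm.trans hb₀)
      rw [intMinor_eq_zero u _ hne (by simp [Function.update_of_ne hne, hb'])]
      simp
    · simp

/-- An integer vector viewed over the rationals. -/
def ratVec {d : ℕ} (v : Fin d → ℤ) : Fin d → ℚ := fun k => v k

theorem ratVec_injective {d : ℕ} : Function.Injective (ratVec (d := d)) := by
  intro v w h
  ext k
  exact Int.cast_injective (α := ℚ) (congrFun h k)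

theorem exists_transform {d : ℕ} (W : Submodule ℚ (Fin d → ℚ)) {j : ℕ}
    (hj : j = Module.finrank ℚ W) (u u' : Fin j → Fin d → ℤ)
    (hu : ∀ a, ratVec (u a) ∈ W) (hui : LinearIndependent ℚ fun a => ratVec (u a))
    (hu' : ∀ a, ratVec (u' a) ∈ W) :
    ∃ A : Matrix (Fin j) (Fin j) ℚ, ∀ a k, (u' a k : ℚ) = ∑ b, A a b * u b k := by
  have hspan : Submodule.span ℚ (range fun a => ratVec (u a)) = W := by
    refine Submodule.eq_of_le_of_finrank_eq (Submodule.span_le.2 ?_) ?_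
    · rintro _ ⟨a, rfl⟩; exact hu a
    · rw [finrank_span_eq_card hui, Fintype.card_fin, hj]
  have : ∀ a, ∃ c : Fin j → ℚ, ∑ b, c b • ratVec (u b) = ratVec (u' a) := fun a =>
    (Submodule.mem_span_range_iff_exists_fun ℚ).1 (hspan.symm ▸ hu' a)
  choose A hA using this
  refine ⟨A, fun a k => ?_⟩
  have := congrFun (hA a) k
  simpa [ratVec, Finset.sum_apply] using this.symm

theorem exists_integral_basis {d : ℕ} (W : Submodule ℚ (Fin d → ℚ)) :
    ∃ u : Fin (Module.finrank ℚ W) → Fin d → ℤ, (∀ a, ratVec (u a) ∈ W) ∧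
      LinearIndependent ℚ fun a => ratVec (u a) := by
  let B := Module.finBasis ℚ W
  obtain ⟨N, hN⟩ := IsLocalization.exist_integer_multiples_of_finite (nonZeroDivisors ℤ)
    (fun p : Fin (Module.finrank ℚ W) × Fin d => (B p.1 : Fin d → ℚ) p.2)
  choose u hu using hN
  have hN0 : ((N : ℤ) : ℚ) ≠ 0 := by
    exact_mod_cast nonZeroDivisors.ne_zero N.2
  have hEq : ∀ a, ratVec (fun k => u (a, k)) = ((N : ℤ) : ℚ) • (B a : Fin d → ℚ) := by
    intro a
    ext k
    have := hu (a, k)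
    simpa [ratVec, Algebra.smul_def] using this
  refine ⟨fun a k => u (a, k), fun a => ?_, ?_⟩
  · rw [hEq]; exact W.smul_mem _ (B a).2
  · have h1 : LinearIndependent ℚ fun a => (B a : Fin d → ℚ) :=
      B.linearIndependent.map' W.subtype W.ker_subtype
    simp only [hEq]
    exact h1.units_smul fun _ => Units.mk0 _ hN0

/-- Every rational subspace contains an independent integral tuple of minimal covolume. -/
theorem exists_minimal_tuple {d : ℕ} (W : Submodule ℚ (Fin d → ℚ)) :
    ∃ u : Fin (Module.finrank ℚ W) → Fin d → ℤ, (∀ a, ratVec (u a) ∈ W) ∧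
      (LinearIndependent ℚ fun a => ratVec (u a)) ∧
      ∀ u' : Fin (Module.finrank ℚ W) → Fin d → ℤ, (∀ a, ratVec (u' a) ∈ W) →
        (LinearIndependent ℚ fun a => ratVec (u' a)) →
        ∀ M : Matrix (Fin d) (Fin d) ℝ, wedgeNorm M u ≤ wedgeNorm M u' := by
  obtain ⟨u₀, hu₀, hi₀⟩ := exists_integral_basis W
  obtain ⟨I, hI⟩ := exists_intMinor_ne_zero u₀ hi₀
  obtain ⟨u, ⟨huW, hui⟩, hmin⟩ := (measure fun u : Fin (Module.finrank ℚ W) → Fin d → ℤ =>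
    (intMinor u I).natAbs).wf.has_min
      {u | (∀ a, ratVec (u a) ∈ W) ∧ LinearIndependent ℚ fun a => ratVec (u a)} ⟨u₀, hu₀, hi₀⟩
  have hne : ∀ u' : Fin (Module.finrank ℚ W) → Fin d → ℤ, (∀ a, ratVec (u' a) ∈ W) →
      (LinearIndependent ℚ fun a => ratVec (u' a)) → intMinor u' I ≠ 0 := by
    intro u' h1 h2 h0
    obtain ⟨A, hA⟩ := exists_transform W rfl u' u₀ h1 h2 hu₀
    have := intMinor_transform u' u₀ A hA I
    rw [h0, Int.cast_zero, mul_zero] at this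
    exact hI (by exact_mod_cast this)
  refine ⟨u, huW, hui, fun u' h1 h2 M => ?_⟩
  obtain ⟨A, hA⟩ := exists_transform W rfl u u' huW hui h1
  have hm := intMinor_transform u u' A hA I
  have hle : (intMinor u I).natAbs ≤ (intMinor u' I).natAbs := not_lt.1 (hmin u' ⟨h1, h2⟩)
  have hle' : |(intMinor u I : ℚ)| ≤ |(intMinor u' I : ℚ)| := by
    have : |intMinor u I| ≤ |intMinor u' I| := by
      rw [Int.abs_eq_natAbs, Int.abs_eq_natAbs]; exact_mod_cast hle
    exact_mod_cast this
  have hpos : 0 < |(intMinor u I : ℚ)| := abs_pos.2 (by exact_mod_cast hne u huW hui)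
  rw [hm, abs_mul] at hle'
  have hdet : (1 : ℚ) ≤ |A.det| := by
    by_contra hlt
    push Not at hlt
    nlinarith
  have hdet' : (1 : ℝ) ≤ |(A.det : ℝ)| := by exact_mod_cast hdet
  rw [wedgeNorm_transform M u u' A hA]
  exact le_mul_of_one_le_left (wedgeNorm_nonneg M u) hdet'

/-- A minimal integral tuple of a rational subspace. -/
noncomputable def minTuple {d : ℕ} (W : Submodule ℚ (Fin d → ℚ)) :
    Fin (Module.finrank ℚ W) → Fin d → ℤ := (exists_minimal_tuple W).choose

/-- The covolume function of a rational subspace. -/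
noncomputable def covol {d : ℕ} (M : Matrix (Fin d) (Fin d) ℝ) (W : Submodule ℚ (Fin d → ℚ)) : ℝ :=
  wedgeNorm M (minTuple W)

theorem minTuple_mem {d : ℕ} (W : Submodule ℚ (Fin d → ℚ)) (a) : ratVec (minTuple W a) ∈ W :=
  (exists_minimal_tuple W).choose_spec.1 a

theorem minTuple_independent {d : ℕ} (W : Submodule ℚ (Fin d → ℚ)) :
    LinearIndependent ℚ fun a => ratVec (minTuple W a) :=
  (exists_minimal_tuple W).choose_spec.2.1

theorem covol_le {d : ℕ} (M : Matrix (Fin d) (Fin d) ℝ) (W : Submodule ℚ (Fin d → ℚ)) {j : ℕ}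
    (hj : j = Module.finrank ℚ W) (u : Fin j → Fin d → ℤ) (hu : ∀ a, ratVec (u a) ∈ W)
    (hui : LinearIndependent ℚ fun a => ratVec (u a)) : covol M W ≤ wedgeNorm M u := by
  subst hj
  exact (exists_minimal_tuple W).choose_spec.2.2 u hu hui M

theorem covol_bot {d : ℕ} (M : Matrix (Fin d) (Fin d) ℝ) : covol M ⊥ = 1 := by
  have h0 : Module.finrank ℚ (⊥ : Submodule ℚ (Fin d → ℚ)) = 0 := finrank_bot ℚ _
  have key : ∀ (j : ℕ) (u : Fin j → Fin d → ℤ), j = 0 → wedgeNorm M u = 1 := by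
    rintro j u rfl
    have : (fun I : Fin 0 → Fin d => realMinor M u I) = fun _ => 1 := by
      ext I; simp [realMinor]
    rw [wedgeNorm, this]
    simp
  exact key _ _ h0

theorem covol_sup_span_le {d : ℕ} (M : Matrix (Fin d) (Fin d) ℝ) (W : Submodule ℚ (Fin d → ℚ))
    (v : Fin d → ℤ) (hv : ratVec v ∉ W) :
    covol M (W ⊔ Submodule.span ℚ {ratVec v}) ≤
      d * ‖M.mulVec fun k => (v k : ℝ)‖ * covol M W := by
  set W' := W ⊔ Submodule.span ℚ {ratVec v} with hW'
  have hli : LinearIndependent ℚ fun a => ratVec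
      ((Fin.cons v (minTuple W) : Fin (Module.finrank ℚ W + 1) → Fin d → ℤ) a) := by
    have : (fun a => ratVec
        ((Fin.cons v (minTuple W) : Fin (Module.finrank ℚ W + 1) → Fin d → ℤ) a)) =
        Fin.cons (ratVec v) fun a => ratVec (minTuple W a) := by
      ext a
      refine Fin.cases ?_ (fun a => ?_) a <;> simp
    rw [this]
    refine (minTuple_independent W).finCons fun hmem => hv ?_
    refine (Submodule.span_le.2 ?_) hmem
    rintro _ ⟨a, rfl⟩
    exact minTuple_mem W a
  have hmem : ∀ a, ratVec
      ((Fin.cons v (minTuple W) : Fin (Module.finrank ℚ W + 1) → Fin d → ℤ) a) ∈ W' := by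
    intro a
    refine Fin.cases ?_ (fun a => ?_) a
    · rw [Fin.cons_zero]
      exact (le_sup_right : _ ≤ W') (Submodule.mem_span_singleton_self _)
    · rw [Fin.cons_succ]
      exact (le_sup_left : W ≤ W') (minTuple_mem W a)
  have hle : Module.finrank ℚ W + 1 ≤ d := by
    simpa using hli.fintype_card_le_finrank
  have hrank : Module.finrank ℚ W + 1 = Module.finrank ℚ W' := by
    refine le_antisymm (Submodule.finrank_lt_finrank_of_lt (lt_of_le_of_ne le_sup_left ?_)) ?_
    · intro h
      refine hv (h.symm ▸ ?_)
      exact (le_sup_right : _ ≤ W') (Submodule.mem_span_singleton_self _)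
    · refine (Submodule.finrank_add_le_finrank_add_finrank _ _).trans ?_
      gcongr
      exact (finrank_span_le_card _).trans (by simp)
  refine (covol_le M W' hrank _ hmem hli).trans ((wedgeNorm_cons_le M (minTuple W) v).trans ?_)
  have := wedgeNorm_nonneg M (minTuple W)
  rw [covol]
  gcongr
  exact_mod_cast hle

/-- Subspaces spanned by vectors from a given set of integer vectors, other than zero. -/
def spannedBy {d : ℕ} (V : Set (Fin d → ℤ)) : Set (Submodule ℚ (Fin d → ℚ)) :=
  {W | W ≠ ⊥ ∧ ∃ A ⊆ V, W = Submodule.span ℚ (ratVec '' A)}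

theorem spannedBy_finite {d : ℕ} {V : Set (Fin d → ℤ)} (hV : V.Finite) : (spannedBy V).Finite := by
  refine (hV.finite_subsets.image fun A => Submodule.span ℚ (ratVec '' A)).subset ?_
  rintro W ⟨-, A, hA, rfl⟩
  exact ⟨A, hA, rfl⟩

theorem ratVec_ne_zero {d : ℕ} {v : Fin d → ℤ} (hv : v ≠ 0) : ratVec v ≠ 0 := fun h =>
  hv (ratVec_injective (h.trans (by ext k; simp [ratVec])))

theorem no_short_vector_of_marked {d : ℕ} (M : ℝ → Matrix (Fin d) (Fin d) ℝ) (y ε : ℝ)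
    (hε1 : ε ≤ 1) (V : Set (Fin d → ℤ))
    (hV : ∀ v : Fin d → ℤ, ‖(M y).mulVec fun k => (v k : ℝ)‖ ≤ 1 → v ∈ V)
    (S : Finset (Submodule ℚ (Fin d → ℚ))) (hS : (S : Set _) = spannedBy V)
    (hmark : Marked (fun W y => covol (M y) W) ε S y) (v : Fin d → ℤ) (hv : v ≠ 0) :
    ε ≤ d * ‖(M y).mulVec fun k => (v k : ℝ)‖ := by
  classical
  obtain ⟨F, hFS, hchain, hF, hmax⟩ := hmark
  by_contra hlt
  push Not at hlt
  have hd : (1 : ℝ) ≤ d := by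
    have : 0 < d := by
      rcases Nat.eq_zero_or_pos d with rfl | h
      · exact absurd (Subsingleton.elim v 0) hv
      · exact h
    exact_mod_cast this
  have hvV : v ∈ V := hV v (by nlinarith [norm_nonneg ((M y).mulVec fun k => (v k : ℝ))])
  obtain ⟨Γ₀, hspan, hcov, hvΓ, htop, hcomp⟩ : ∃ Γ₀ : Submodule ℚ (Fin d → ℚ),
      (∃ A ⊆ V, Γ₀ = Submodule.span ℚ (ratVec '' A)) ∧ covol (M y) Γ₀ ≤ 1 ∧ ratVec v ∉ Γ₀ ∧
      (∀ Γ ∈ F, ratVec v ∉ Γ → Γ ≤ Γ₀) ∧ ∀ Γ ∈ F, Γ ≤ Γ₀ ∨ Γ₀ ≤ Γ := by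
    set G := F.filter fun Γ => ratVec v ∉ Γ with hG
    rcases G.eq_empty_or_nonempty with hGe | hGne
    · refine ⟨⊥, ⟨∅, empty_subset _, by simp⟩, (covol_bot _).le, ?_, ?_, fun _ _ => Or.inr bot_le⟩
      · simpa using ratVec_ne_zero hv
      · intro Γ hΓ hvΓ
        have : Γ ∈ G := Finset.mem_filter.2 ⟨hΓ, hvΓ⟩
        simp [hGe] at this
    · obtain ⟨Γ₀, hΓ₀, hΓmax⟩ := G.exists_maximal hGne
      have hΓF := (Finset.mem_filter.1 hΓ₀).1
      have hcomp : ∀ Γ ∈ F, Γ ≤ Γ₀ ∨ Γ₀ ≤ Γ := fun Γ hΓ => hchain.total hΓ hΓF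
      refine ⟨Γ₀, ?_, (hF _ hΓF).2, (Finset.mem_filter.1 hΓ₀).2, ?_, hcomp⟩
      · have : Γ₀ ∈ spannedBy V := hS ▸ (Finset.mem_coe.2 (hFS hΓF))
        exact this.2
      · intro Γ hΓ hvΓ
        rcases hcomp Γ hΓ with h | h
        · exact h
        · exact hΓmax (Finset.mem_filter.2 ⟨hΓ, hvΓ⟩) h
  set W' := Γ₀ ⊔ Submodule.span ℚ {ratVec v} with hW'
  have hvW : ratVec v ∈ W' := (le_sup_right : _ ≤ W') (Submodule.mem_span_singleton_self _)
  have hWS : W' ∈ S := by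
    rw [← Finset.mem_coe, hS]
    refine ⟨?_, ?_⟩
    · intro h
      rw [h, Submodule.mem_bot] at hvW
      exact ratVec_ne_zero hv hvW
    · obtain ⟨A, hA, hΓA⟩ := hspan
      refine ⟨insert v A, insert_subset hvV hA, ?_⟩
      rw [hW', hΓA, image_insert_eq, insert_eq, Submodule.span_union, sup_comm]
  have hε : ε ≤ covol (M y) W' := by
    by_cases hWF : W' ∈ F
    · exact (hF _ hWF).1
    · refine hε1.trans (hmax W' hWS hWF fun Γ hΓ => ?_)
      by_cases hvΓ' : ratVec v ∈ Γ
      · left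
        refine sup_le ?_ (by simpa [Submodule.span_le] using hvΓ')
        rcases hcomp Γ hΓ with h | h
        · exact absurd (h hvΓ') hvΓ
        · exact h
      · right
        exact (htop Γ hΓ hvΓ').trans le_sup_left
  have := covol_sup_span_le (M y) Γ₀ v hvΓ
  have h2 : d * ‖(M y).mulVec fun k => (v k : ℝ)‖ * covol (M y) Γ₀ ≤
      d * ‖(M y).mulVec fun k => (v k : ℝ)‖ := mul_le_of_le_one_right (by positivity) hcov
  linarith

theorem card_chain_le {d : ℕ} {V : Set (Fin d → ℤ)} (F : Finset (Submodule ℚ (Fin d → ℚ)))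
    (hF : (F : Set _) ⊆ spannedBy V) (hchain : IsChain (· ≤ ·) (F : Set (Submodule ℚ (Fin d → ℚ)))) :
    F.card ≤ d := by
  have hmaps : ∀ W ∈ F, Module.finrank ℚ W ∈ Finset.Icc 1 d := by
    intro W hW
    rw [Finset.mem_Icc]
    constructor
    · rw [Nat.one_le_iff_ne_zero]
      intro h
      exact (hF hW).1 (Submodule.finrank_eq_zero.1 h)
    · simpa using W.finrank_le
  have hinj : Set.InjOn (fun W : Submodule ℚ (Fin d → ℚ) => Module.finrank ℚ W) F := by
    intro W hW W' hW' h
    rcases hchain.total hW hW' with hle | hle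
    · exact Submodule.eq_of_le_of_finrank_eq hle h
    · exact (Submodule.eq_of_le_of_finrank_eq hle h.symm).symm
  simpa using Finset.card_le_card_of_injOn _ hmaps hinj

/-- The curve with an additional constant first coordinate. -/
def liftCurve {n : ℕ} (f : Fin n → ℝ → ℝ) (y : ℝ) : Fin (n + 1) → ℝ := Fin.cons 1 fun i => f i y

/-- Uniform nondegeneracy of a curve on a set: derivatives of order up to `n` exist, they are
bounded, and every linear combination of the coordinates has a derivative of order between `1` and
`n` that is uniformly bounded below. -/
structure UniformlyNondegenerate {n : ℕ} (D : Fin n → ℕ → ℝ → ℝ) (U : Set ℝ) (A₁ A₂ : ℝ) :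
    Prop where
  pos_lower : 0 < A₁
  pos_upper : 0 < A₂
  hasDerivAt : ∀ i, ∀ k < n, ∀ t ∈ U, HasDerivAt (D i k) (D i (k + 1) t) t
  lower : ∀ c : Fin n → ℝ, ∃ j, 1 ≤ j ∧ j ≤ n ∧ ∀ t ∈ U, A₁ * ‖c‖ ≤ |∑ i, c i * D i j t|
  upper : ∀ c : Fin n → ℝ, ∀ j ≤ n, ∀ t ∈ U, |∑ i, c i * D i j t| ≤ A₂ * ‖c‖

namespace UniformlyNondegenerate

variable {n : ℕ} {D : Fin n → ℕ → ℝ → ℝ} {U : Set ℝ} {A₁ A₂ : ℝ}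

theorem hasDerivAt_combination (h : UniformlyNondegenerate D U A₁ A₂) (c₀ : ℝ) (c : Fin n → ℝ)
    {k : ℕ} (hk : k < n) {t : ℝ} (ht : t ∈ U) :
    HasDerivAt (fun t => (if k = 0 then c₀ else 0) + ∑ i, c i * D i k t)
      ((if k + 1 = 0 then c₀ else 0) + ∑ i, c i * D i (k + 1) t) t := by
  rw [if_neg k.succ_ne_zero, zero_add]
  refine HasDerivAt.const_add _ (HasDerivAt.fun_sum fun i _ => ?_)
  exact (h.hasDerivAt i k hk t ht).const_mul _

theorem abs_coord_le (h : UniformlyNondegenerate D U A₁ A₂) (i : Fin n) {j : ℕ} (hj : j ≤ n)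
    {t : ℝ} (ht : t ∈ U) : |D i j t| ≤ A₂ := by
  classical
  have := h.upper (Pi.single i 1) j hj t ht
  have hn : ‖(Pi.single i 1 : Fin n → ℝ)‖ ≤ 1 := by
    refine (pi_norm_le_iff_of_nonneg zero_le_one).2 fun k => ?_
    by_cases hk : k = i
    · subst hk; simp
    · simp [hk]
  have h2 : ∑ k, (Pi.single i 1 : Fin n → ℝ) k * D k j t = D i j t := by
    rw [Finset.sum_eq_single i]
    · simp
    · intro k _ hk; simp [hk]
    · simp
  rw [h2] at this
  exact this.trans (mul_le_of_le_one_right h.pos_upper.le hn)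

theorem exists_finset_min {P : ℕ → ℝ → Prop} (hmono : ∀ j ε ε', 0 < ε' → ε' ≤ ε → P j ε → P j ε')
    (hP : ∀ j, ∃ ε, 0 < ε ∧ P j ε) (n : ℕ) : ∃ ε, 0 < ε ∧ ∀ j ≤ n, P j ε := by
  induction n with
  | zero =>
    obtain ⟨ε, h0, h⟩ := hP 0
    exact ⟨ε, h0, fun j hj => by rwa [Nat.le_zero.1 hj]⟩
  | succ n ih =>
    obtain ⟨ε, h0, h⟩ := ih
    obtain ⟨ε', h0', h'⟩ := hP (n + 1)
    refine ⟨min ε ε', lt_min h0 h0', fun j hj => ?_⟩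
    rcases Nat.le_succ_iff.1 hj with hj | rfl
    · exact hmono j ε _ (lt_min h0 h0') (min_le_left _ _) (h j hj)
    · exact hmono _ ε' _ (lt_min h0 h0') (min_le_right _ _) h'

theorem sublevel_combination (n : ℕ) {A₁ A₂ η : ℝ} (hA₁ : 0 < A₁) (hA₂ : 0 < A₂) (hη : 0 < η)
    (hη1 : η ≤ 1) :
    ∃ ε : ℝ, 0 < ε ∧ ε ≤ 1 ∧ ∀ (D : Fin n → ℕ → ℝ → ℝ) (U : Set ℝ),
      UniformlyNondegenerate D U A₁ A₂ → ∀ (c₀ : ℝ) (c : Fin n → ℝ) (x r : ℝ), 0 < r →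
      Metric.closedBall x r ⊆ U → (∃ y ∈ Metric.closedBall x r, 1 ≤ |c₀ + ∑ i, c i * D i 0 y|) →
      volume {y ∈ Metric.closedBall x r | |c₀ + ∑ i, c i * D i 0 y| < ε} ≤
        ENNReal.ofReal (η * r) := by
  obtain ⟨ε, hε, hP⟩ := exists_finset_min
    (P := fun j ε => ∀ ε' ≤ ε, ∀ (s c r : ℝ) (D : ℕ → ℝ → ℝ), 0 < r → 0 ≤ s →
      (∀ i < j, ∀ t ∈ Metric.closedBall c r, HasDerivAt (D i) (D (i + 1) t) t) →
      (∀ t ∈ Metric.closedBall c r, A₁ * s ≤ |D j t| ∧ |D j t| ≤ A₂ * s) →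
      (∃ x ∈ Metric.closedBall c r, 1 ≤ |D 0 x|) →
      volume {t ∈ Metric.closedBall c r | |D 0 t| < ε'} ≤ ENNReal.ofReal (η * r))
    (fun j ε ε' _ hle h δ hδ => h δ (hδ.trans hle))
    (fun j => sublevel_small j A₁ A₂ η hA₁ hA₂ hη hη1) n
  refine ⟨min ε 1, lt_min hε one_pos, min_le_right _ _, ?_⟩
  intro D U h c₀ c x r hr hU hy
  obtain ⟨j, hj1, hjn, hj⟩ := h.lower c
  have := hP j hjn (min ε 1) (min_le_left _ _) ‖c‖ x r
    (fun k t => (if k = 0 then c₀ else 0) + ∑ i, c i * D i k t) hr (norm_nonneg _)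
    (fun k hk t ht => h.hasDerivAt_combination c₀ c (hk.trans_le hjn) (hU ht))
    (fun t ht => ?_) (by simpa using hy)
  · simpa using this
  · have hj0 : j ≠ 0 := by omega
    simp only [hj0, if_false, zero_add]
    exact ⟨hj t (hU ht), h.upper c j hjn t (hU ht)⟩

theorem exists_large_combination (h : UniformlyNondegenerate D U A₁ A₂) {x r : ℝ} (hr : 0 < r)
    (hU : Metric.closedBall x r ⊆ U) :
    ∃ ε : ℝ, 0 < ε ∧ ∀ (c₀ : ℝ) (c : Fin n → ℝ), 1 ≤ ‖c‖ →
      ∃ y ∈ Metric.closedBall x r, ε ≤ |c₀ + ∑ i, c i * D i 0 y| := by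
  obtain ⟨ε, hε, hP⟩ := exists_finset_min
    (P := fun j ε => ∀ (c : ℝ) (D : ℕ → ℝ → ℝ),
      (∀ i < j, ∀ t ∈ Metric.closedBall c r, HasDerivAt (D i) (D (i + 1) t) t) →
      (∀ t ∈ Metric.closedBall c r, A₁ ≤ |D j t|) → ∃ x ∈ Metric.closedBall c r, ε ≤ |D 0 x|)
    (fun j ε ε' _ hle h c D h1 h2 =>
      (h c D h1 h2).imp fun y hy => ⟨hy.1, hle.trans hy.2⟩)
    (fun j => exists_large_value j A₁ r h.pos_lower hr) n
  refine ⟨ε, hε, fun c₀ c hc => ?_⟩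
  obtain ⟨j, hj1, hjn, hj⟩ := h.lower c
  have := hP j hjn x (fun k t => (if k = 0 then c₀ else 0) + ∑ i, c i * D i k t)
    (fun k hk t ht => h.hasDerivAt_combination c₀ c (hk.trans_le hjn) (hU ht))
    (fun t ht => ?_)
  · simpa using this
  · have hj0 : j ≠ 0 := by omega
    simp only [hj0, if_false, zero_add]
    exact (le_mul_of_one_le_right h.pos_lower.le hc).trans (hj t (hU ht))

theorem sum_liftCurve (f : Fin n → ℝ → ℝ) (c : Fin (n + 1) → ℝ) (y : ℝ) :
    ∑ k, c k * liftCurve f y k = c 0 + ∑ i, c (Fin.succ i) * f i y := by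
  simp [liftCurve, Fin.sum_univ_succ]

theorem continuousOn_covol (h : UniformlyNondegenerate D U A₁ A₂) (hn : 1 ≤ n) (q : ℝ)
    (W : Submodule ℚ (Fin (n + 1) → ℚ)) :
    ContinuousOn (fun y => covol (flowMatrix n q (liftCurve (fun i => D i 0) y)) W) U := by
  refine ContinuousOn.norm (continuousOn_pi.2 fun I => ?_)
  obtain ⟨c, hc⟩ := realMinor_flow_eq_sum q (minTuple W) I
  have : (fun y => realMinor (flowMatrix n q (liftCurve (fun i => D i 0) y)) (minTuple W) I) =
      fun y => c 0 + ∑ i, c (Fin.succ i) * D i 0 y := by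
    ext y
    rw [hc _ rfl, sum_liftCurve]
  rw [this]
  refine continuousOn_const.add (continuousOn_finsetSum _ fun i _ => continuousOn_const.mul ?_)
  exact fun t ht => (h.hasDerivAt i 0 hn t ht).continuousAt.continuousWithinAt

theorem sublevel_covol (n : ℕ) {A₁ A₂ η : ℝ} (hA₁ : 0 < A₁) (hA₂ : 0 < A₂) (hη : 0 < η)
    (hη1 : η ≤ 1) :
    ∃ ε : ℝ, 0 < ε ∧ ε ≤ 1 ∧ ∀ (D : Fin n → ℕ → ℝ → ℝ) (U : Set ℝ),
      UniformlyNondegenerate D U A₁ A₂ → ∀ (q : ℝ) (W : Submodule ℚ (Fin (n + 1) → ℚ)) (x r : ℝ),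
      0 < r → Metric.closedBall x r ⊆ U →
      (∃ y ∈ Metric.closedBall x r, 1 ≤ covol (flowMatrix n q (liftCurve (fun i => D i 0) y)) W) →
      volume {y ∈ Metric.closedBall x r |
        covol (flowMatrix n q (liftCurve (fun i => D i 0) y)) W < ε} ≤ ENNReal.ofReal (η * r) := by
  obtain ⟨ε, hε, hε1, H⟩ := sublevel_combination n hA₁ hA₂ hη hη1
  refine ⟨ε, hε, hε1, fun D U h q W x r hr hU hy => ?_⟩
  obtain ⟨y, hy, hy1⟩ := hy
  have hI : ∃ I, 1 ≤ |realMinor (flowMatrix n q (liftCurve (fun i => D i 0) y)) (minTuple W) I| := by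
    by_contra hcon
    push Not at hcon
    refine absurd hy1 (not_le.2 ?_)
    exact (pi_norm_lt_iff one_pos).2 hcon
  obtain ⟨I, hI⟩ := hI
  obtain ⟨c, hc⟩ := realMinor_flow_eq_sum q (minTuple W) I
  have hc' : ∀ y, realMinor (flowMatrix n q (liftCurve (fun i => D i 0) y)) (minTuple W) I =
      c 0 + ∑ i, c (Fin.succ i) * D i 0 y := by
    intro y
    rw [hc _ rfl, sum_liftCurve]
  refine (measure_mono ?_).trans (H D U h (c 0) (fun i => c (Fin.succ i)) x r hr hU
    ⟨y, hy, by rwa [← hc']⟩)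
  rintro t ⟨ht, htε⟩
  refine ⟨ht, ?_⟩
  rw [← hc']
  exact (abs_realMinor_le _ _ I).trans_lt htε

theorem exists_covol_large (h : UniformlyNondegenerate D U A₁ A₂) {x r : ℝ} (hr : 0 < r)
    (hU : Metric.closedBall x r ⊆ U) :
    ∃ Q : ℝ, 1 ≤ Q ∧ ∀ q, Q ≤ q → ∀ W : Submodule ℚ (Fin (n + 1) → ℚ), W ≠ ⊥ →
      ∃ y ∈ Metric.closedBall x r,
        1 ≤ covol (flowMatrix n q (liftCurve (fun i => D i 0) y)) W := by
  obtain ⟨ε, hε, H⟩ := h.exists_large_combination hr hU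
  refine ⟨max 1 (1 / ε), le_max_left _ _, fun q hq W hW => ?_⟩
  have hq1 : 1 ≤ q := (le_max_left _ _).trans hq
  have hqε : 1 ≤ q * ε := (div_le_iff₀ hε).1 ((le_max_right _ _).trans hq)
  have hx : x ∈ Metric.closedBall x r := Metric.mem_closedBall_self hr.le
  have hrank : 1 ≤ Module.finrank ℚ W := by
    rw [Nat.one_le_iff_ne_zero]
    exact fun h0 => hW (Submodule.finrank_eq_zero.1 h0)
  rcases wedgeNorm_flow_lower hrank (minTuple W) (minTuple_independent W) with
    ⟨m, hm, hlow⟩ | hlow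
  · by_cases hm' : ∀ i : Fin n, m i.succ = 0
    · have hm0 : m 0 ≠ 0 := by
        intro h0
        exact hm (funext fun k => Fin.cases h0 hm' k)
      refine ⟨x, hx, le_trans ?_ (hlow q _ hq1)⟩
      rw [sum_liftCurve _ (fun k => (m k : ℝ))]
      simp only [hm', Int.cast_zero, zero_mul, Finset.sum_const_zero, add_zero]
      have : (1 : ℝ) ≤ |(m 0 : ℝ)| := by exact_mod_cast Int.one_le_abs hm0
      nlinarith
    · push Not at hm'
      obtain ⟨i, hi⟩ := hm'
      obtain ⟨y, hy, hye⟩ := H (m 0) (fun i => m i.succ) (by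
        have h1 : (1 : ℝ) ≤ ‖(m i.succ : ℝ)‖ := by
          rw [Real.norm_eq_abs]; exact_mod_cast Int.one_le_abs hi
        exact h1.trans (norm_le_pi_norm (fun i : Fin n => (m i.succ : ℝ)) i))
      refine ⟨y, hy, le_trans ?_ (hlow q _ hq1)⟩
      rw [sum_liftCurve _ (fun k => (m k : ℝ))]
      exact hqε.trans (by gcongr)
  · exact ⟨x, hx, hlow q _ hq1 rfl⟩

theorem finite_bounded (d : ℕ) (K : ℝ) : {v : Fin d → ℤ | ∀ k, |(v k : ℝ)| ≤ K}.Finite := by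
  refine (Set.finite_Icc (fun _ : Fin d => -⌈K⌉) (fun _ => ⌈K⌉)).subset fun v hv => ?_
  refine ⟨fun k => ?_, fun k => ?_⟩
  · have := (abs_le.1 (hv k)).1
    have h2 : (-(⌈K⌉ : ℤ) : ℝ) ≤ v k := (neg_le_neg (Int.le_ceil K)).trans this
    exact_mod_cast h2
  · have := (abs_le.1 (hv k)).2
    have h2 : (v k : ℝ) ≤ ⌈K⌉ := this.trans (Int.le_ceil K)
    exact_mod_cast h2

theorem bounded_of_short (h : UniformlyNondegenerate D U A₁ A₂) {q : ℝ} (hq : 1 ≤ q) {y : ℝ}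
    (hy : y ∈ U) (v : Fin (n + 1) → ℤ)
    (hv : ‖(flowMatrix n q (liftCurve (fun i => D i 0) y)).mulVec fun k => (v k : ℝ)‖ ≤ 1)
    (k : Fin (n + 1)) : |(v k : ℝ)| ≤ q + 1 + n * (q * A₂) := by
  have hq0 : 0 < q := by linarith
  have hA := h.pos_upper
  have hcoord : ∀ k, |(flowMatrix n q (liftCurve (fun i => D i 0) y)).mulVec
      (fun k => (v k : ℝ)) k| ≤ 1 := fun k => (norm_le_pi_norm _ k).trans hv
  have hsucc : ∀ i : Fin n, |(v i.succ : ℝ)| ≤ q := by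
    intro i
    have := hcoord i.succ
    rw [flowMatrix_mulVec_succ, abs_mul, abs_of_pos (inv_pos.2 hq0), inv_mul_le_iff₀ hq0] at this
    linarith
  have hnn : 0 ≤ (n : ℝ) * (q * A₂) := by positivity
  refine Fin.cases ?_ (fun i => (hsucc i).trans (by linarith)) k
  have h0 := hcoord 0
  rw [flowMatrix_mulVec_zero, sum_liftCurve _ (fun k => (v k : ℝ)), abs_mul,
    abs_of_pos (by positivity : 0 < q ^ n)] at h0
  have h1 : |(v 0 : ℝ) + ∑ i : Fin n, (v i.succ : ℝ) * D i 0 y| ≤ 1 :=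
    (le_mul_of_one_le_left (abs_nonneg _) (one_le_pow₀ hq)).trans h0
  have h2 : |∑ i : Fin n, (v i.succ : ℝ) * D i 0 y| ≤ n * (q * A₂) := by
    refine (Finset.abs_sum_le_sum_abs _ _).trans ?_
    refine (Finset.sum_le_card_nsmul _ _ (q * A₂) fun i _ => ?_).trans (by simp)
    rw [abs_mul]
    exact mul_le_mul (hsucc i) (h.abs_coord_le i (Nat.zero_le _) hy) (abs_nonneg _) hq0.le
  have h3 : (v 0 : ℝ) = ((v 0 : ℝ) + ∑ i : Fin n, (v i.succ : ℝ) * D i 0 y) -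
    ∑ i : Fin n, (v i.succ : ℝ) * D i 0 y := by ring
  rw [h3]
  exact (abs_sub _ _).trans (by linarith)

/-- On at least half of every small ball the lattices of the flow have no short vectors. -/
theorem measure_short_vectors (hn : 1 ≤ n) (h : UniformlyNondegenerate D U A₁ A₂) :
    ∃ ε : ℝ, 0 < ε ∧ ∀ x r : ℝ, 0 < r → Metric.closedBall x (3 ^ (n + 1) * r) ⊆ U →
      ∃ Q : ℝ, 1 ≤ Q ∧ ∀ q, Q ≤ q →
        volume (Metric.closedBall x r \ {y | ∀ v : Fin (n + 1) → ℤ, v ≠ 0 →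
          ε ≤ ‖(flowMatrix n q (liftCurve (fun i => D i 0) y)).mulVec fun k => (v k : ℝ)‖}) ≤
            ENNReal.ofReal r := by
  classical
  obtain ⟨C, hC, HC⟩ := quantitative_nondivergence (n + 1)
  set η : ℝ := 1 / (C + 1) with hη
  have hη0 : 0 < η := by positivity
  have hη1 : η ≤ 1 := by rw [hη, div_le_one (by positivity)]; linarith
  obtain ⟨ε, hε, hε1, Hε⟩ := sublevel_covol n h.pos_lower h.pos_upper hη0 hη1
  refine ⟨ε / (n + 1), by positivity, fun x r hr hball => ?_⟩
  have hsub : Metric.closedBall x r ⊆ U := by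
    refine (Metric.closedBall_subset_closedBall ?_).trans hball
    exact le_mul_of_one_le_left hr.le (one_le_pow₀ (by norm_num))
  obtain ⟨Q, hQ1, HQ⟩ := h.exists_covol_large hr hsub
  refine ⟨Q, hQ1, fun q hq => ?_⟩
  have hq1 : 1 ≤ q := hQ1.trans hq
  set V : Set (Fin (n + 1) → ℤ) := {v | ∀ k, |(v k : ℝ)| ≤ q + 1 + n * (q * A₂)} with hV
  have hfin := spannedBy_finite (finite_bounded (n + 1) (q + 1 + n * (q * A₂)))
  have hS : (hfin.toFinset : Set _) = spannedBy V := hfin.coe_toFinset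
  have key := HC (fun W y => covol (flowMatrix n q (liftCurve (fun i => D i 0) y)) W) U ε η hη0.le
    (fun W => h.continuousOn_covol hn q W) (fun W c r hr hU hy => Hε D U h q W c r hr hU hy)
    hfin.toFinset (fun F hF hch => card_chain_le F
      (by rw [← hS]; exact Finset.coe_subset.2 hF) hch) x r hr hball
    (fun W hW => HQ q hq W (hfin.mem_toFinset.1 hW).1)
  refine (measure_mono ?_).trans (key.trans (ENNReal.ofReal_le_ofReal ?_))
  · rintro y ⟨hy, hyn⟩
    refine ⟨hy, fun hmark => hyn fun v hv => ?_⟩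
    have := no_short_vector_of_marked
      (fun y => flowMatrix n q (liftCurve (fun i => D i 0) y)) y ε hε1 V
      (fun v hv => h.bounded_of_short hq1 (hsub hy) v hv) hfin.toFinset hS hmark v hv
    rw [div_le_iff₀ (by positivity)]
    push_cast at this
    linarith
  · refine mul_le_of_le_one_left hr.le ?_
    rw [hη, mul_one_div, div_le_one (by positivity)]
    linarith

end UniformlyNondegenerate

theorem hasDerivAt_iteratedDerivWithin {a b : ℝ} (hab : a < b) {n : ℕ} {f : ℝ → ℝ}
    (hf : ContDiffOn ℝ n f (Icc a b)) {k : ℕ} (hk : k < n) {t : ℝ} (ht : t ∈ Ioo a b) :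
    HasDerivAt (iteratedDerivWithin k f (Icc a b)) (iteratedDerivWithin (k + 1) f (Icc a b) t) t := by
  have h1 := hf.differentiableOn_iteratedDerivWithin (m := k) (by exact_mod_cast hk)
    (uniqueDiffOn_Icc hab) t (Ioo_subset_Icc_self ht)
  rw [iteratedDerivWithin_succ]
  exact h1.hasDerivWithinAt.hasDerivAt (Icc_mem_nhds ht.1 ht.2)

theorem continuousAt_iteratedDerivWithin {a b : ℝ} (hab : a < b) {n : ℕ} {f : ℝ → ℝ}
    (hf : ContDiffOn ℝ n f (Icc a b)) {k : ℕ} (hk : k ≤ n) {t : ℝ} (ht : t ∈ Ioo a b) :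
    ContinuousAt (iteratedDerivWithin k f (Icc a b)) t :=
  (hf.continuousOn_iteratedDerivWithin (m := k) (by exact_mod_cast hk)
    (uniqueDiffOn_Icc hab)).continuousAt (Icc_mem_nhds ht.1 ht.2)

theorem exists_vecMul_lower {n : ℕ} (hn : 1 ≤ n) (A : Matrix (Fin n) (Fin n) ℝ) (hA : A.det ≠ 0) :
    ∃ κ : ℝ, 0 < κ ∧ ∀ c : Fin n → ℝ, ∃ j, κ * ‖c‖ ≤ |∑ i, c i * A i j| := by
  have hinj : LinearMap.ker A.vecMulLinear = ⊥ := by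
    rw [LinearMap.ker_eq_bot]
    exact Matrix.vecMul_injective_of_isUnit ((Matrix.isUnit_iff_isUnit_det A).2 hA.isUnit)
  obtain ⟨K, hK, hanti⟩ := LinearMap.exists_antilipschitzWith A.vecMulLinear hinj
  have hK' : (0 : ℝ) < K := hK
  refine ⟨(K : ℝ)⁻¹ / 2, by positivity, fun c => ?_⟩
  rcases eq_or_ne c 0 with rfl | hc
  · exact ⟨⟨0, hn⟩, by simp⟩
  · have hc0 : 0 < ‖c‖ := norm_pos_iff.2 hc
    have h1 : ‖c‖ ≤ K * ‖A.vecMulLinear c‖ := by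
      simpa using hanti.le_mul_dist c 0
    by_contra hcon
    push Not at hcon
    have h2 : ‖A.vecMulLinear c‖ < (K : ℝ)⁻¹ * ‖c‖ := by
      refine (pi_norm_lt_iff (by positivity)).2 fun j => ?_
      have h3 : A.vecMulLinear c j = ∑ i, c i * A i j := rfl
      rw [h3, Real.norm_eq_abs]
      refine (hcon j).trans ?_
      rw [div_mul_eq_mul_div]
      exact half_lt_self (by positivity)
    rw [lt_inv_mul_iff₀ hK'] at h2
    linarith

theorem exists_uniformlyNondegenerate {n : ℕ} (hn : 1 ≤ n) {a b : ℝ} (hab : a < b)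
    (f : Fin n → ℝ → ℝ) (hf : ∀ i, ContDiffOn ℝ n (f i) (Icc a b)) {x₀ : ℝ} (hx₀ : x₀ ∈ Ioo a b)
    (hW : (Matrix.of fun i j : Fin n =>
      iteratedDerivWithin ((j : ℕ) + 1) (f i) (Icc a b) x₀).det ≠ 0) :
    ∃ R A₁ A₂ κ s : ℝ, ∃ i₀ : Fin n, 0 < R ∧ 0 < κ ∧ |s| = 1 ∧ Metric.closedBall x₀ R ⊆ Ioo a b ∧
      UniformlyNondegenerate (fun i k => iteratedDerivWithin k (f i) (Icc a b))
        (Metric.closedBall x₀ R) A₁ A₂ ∧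
      ∀ t ∈ Metric.closedBall x₀ R, κ ≤ s * iteratedDerivWithin 1 (f i₀) (Icc a b) t := by
  set D : Fin n → ℕ → ℝ → ℝ := fun i k => iteratedDerivWithin k (f i) (Icc a b) with hD
  obtain ⟨κ, hκ, Hκ⟩ := exists_vecMul_lower hn _ hW
  have hn0 : (0 : ℝ) < n := by exact_mod_cast hn
  obtain ⟨i₀, hi₀⟩ : ∃ i₀, D i₀ 1 x₀ ≠ 0 := by
    by_contra hcon
    push Not at hcon
    refine hW (Matrix.det_eq_zero_of_column_eq_zero ⟨0, hn⟩ fun i => hcon i)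
  set δ : ℝ := min (κ / (2 * n)) (|D i₀ 1 x₀| / 2) with hδ
  have hδ0 : 0 < δ := by have := abs_pos.2 hi₀; positivity
  have hev : ∀ᶠ t in nhds x₀, t ∈ Ioo a b ∧
      ∀ i : Fin n, ∀ j : Fin (n + 1), |D i j t - D i j x₀| < δ := by
    refine Filter.Eventually.and (Ioo_mem_nhds hx₀.1 hx₀.2)
      (eventually_all.2 fun i => eventually_all.2 fun j => ?_)
    exact (continuousAt_iteratedDerivWithin hab (hf i) (Nat.lt_succ_iff.1 j.2) hx₀).eventually
      (Metric.ball_mem_nhds _ hδ0)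
  obtain ⟨R, hR, hball⟩ := Metric.nhds_basis_closedBall.eventually_iff.1 hev
  have hclose : ∀ t ∈ Metric.closedBall x₀ R, ∀ i, ∀ j ≤ n, |D i j t - D i j x₀| ≤ δ :=
    fun t ht i j hj => ((hball ht).2 i ⟨j, Nat.lt_succ_iff.2 hj⟩).le
  set B : ℝ := ∑ i, ∑ j ∈ Finset.range (n + 1), |D i j x₀| + δ with hB
  have hB0 : 0 < B := by positivity
  have hsum : ∀ (c : Fin n → ℝ) (j : ℕ) (w : Fin n → ℝ) (K : ℝ), (∀ i, |w i| ≤ K) →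
      |∑ i, c i * w i| ≤ n * (K * ‖c‖) := by
    intro c j w K hK
    refine (Finset.abs_sum_le_sum_abs _ _).trans ?_
    refine (Finset.sum_le_card_nsmul _ _ (K * ‖c‖) fun i _ => ?_).trans (by simp)
    rw [abs_mul, mul_comm]
    have h0 : 0 ≤ K := (abs_nonneg _).trans (hK i)
    exact mul_le_mul (hK i) (norm_le_pi_norm c i) (abs_nonneg _) h0
  refine ⟨R, κ / 2, n * B, |D i₀ 1 x₀| / 2, SignType.sign (D i₀ 1 x₀), i₀, hR,
    by have := abs_pos.2 hi₀; positivity, ?_, fun t ht => (hball ht).1,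
    ⟨by positivity, by positivity, ?_, ?_, ?_⟩, ?_⟩
  · rcases lt_or_gt_of_ne hi₀ with h | h
    · simp [sign_neg h]
    · simp [sign_pos h]
  · intro i k hk t ht
    exact hasDerivAt_iteratedDerivWithin hab (hf i) hk (hball ht).1
  · intro c
    obtain ⟨j, hj⟩ := Hκ c
    refine ⟨j + 1, by omega, j.2, fun t ht => ?_⟩
    have hj' : κ * ‖c‖ ≤ |∑ i, c i * D i (j + 1) x₀| := hj
    have h1 := hsum c (j + 1) (fun i => D i (j + 1) t - D i (j + 1) x₀) δ
      (fun i => hclose t ht i _ j.2)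
    have h2 : (n : ℝ) * (δ * ‖c‖) ≤ κ / 2 * ‖c‖ := by
      have : (n : ℝ) * δ ≤ κ / 2 := by
        calc (n : ℝ) * δ ≤ n * (κ / (2 * n)) := by gcongr; exact min_le_left _ _
          _ = κ / 2 := by field_simp
      rw [← mul_assoc]
      gcongr
    have h3 : ∑ i, c i * D i (j + 1) x₀ = ∑ i, c i * D i (j + 1) t -
        ∑ i, c i * (D i (j + 1) t - D i (j + 1) x₀) := by
      rw [← Finset.sum_sub_distrib]
      exact Finset.sum_congr rfl fun i _ => by ring
    have h4 := abs_sub (∑ i, c i * D i (j + 1) t) (∑ i, c i * (D i (j + 1) t - D i (j + 1) x₀))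
    rw [← h3] at h4
    change κ / 2 * ‖c‖ ≤ |∑ i, c i * D i (j + 1) t|
    linarith
  · intro c j hj t ht
    rw [mul_assoc]
    refine hsum c j (fun i => D i j t) B fun i => ?_
    have h1 := hclose t ht i j hj
    have h2 : |D i j x₀| ≤ ∑ i, ∑ j ∈ Finset.range (n + 1), |D i j x₀| := by
      refine le_trans ?_ (Finset.single_le_sum
        (f := fun i => ∑ j ∈ Finset.range (n + 1), |D i j x₀|)
        (fun i _ => Finset.sum_nonneg fun j _ => abs_nonneg _) (Finset.mem_univ i))
      exact Finset.single_le_sum (f := fun j => |D i j x₀|) (fun j _ => abs_nonneg _)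
        (Finset.mem_range.2 (Nat.lt_succ_iff.2 hj))
    have h3 := abs_sub_abs_le_abs_sub (D i j t) (D i j x₀)
    change |D i j t| ≤ B
    linarith
  · intro t ht
    have h1 : |D i₀ 1 t - D i₀ 1 x₀| ≤ |D i₀ 1 x₀| / 2 :=
      (hclose t ht i₀ 1 hn).trans (min_le_right _ _)
    change _ ≤ _ * D i₀ 1 t
    have h2 := abs_le.1 h1
    rcases lt_or_gt_of_ne hi₀ with h | h
    · rw [sign_neg h]
      rw [abs_of_neg h] at h2 ⊢
      norm_num
      linarith
    · rw [sign_pos h]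
      rw [abs_of_pos h] at h2 ⊢
      norm_num
      linarith

theorem exists_bounded_derivative {a b : ℝ} (hab : a < b) {f : ℝ → ℝ}
    (hf : ContDiffOn ℝ 2 f (Icc a b)) :
    ∃ (f' : ℝ → ℝ) (L : ℝ), 0 < L ∧ ∀ t ∈ Ioo a b, HasDerivAt f (f' t) t ∧ |f' t| ≤ L := by
  obtain ⟨L, hL⟩ := isCompact_Icc.exists_bound_of_continuousOn
    (hf.continuousOn_iteratedDerivWithin (m := 1) (by norm_num) (uniqueDiffOn_Icc hab))
  refine ⟨iteratedDerivWithin 1 f (Icc a b), max L 1, by positivity, fun t ht => ⟨?_, ?_⟩⟩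
  · simpa using hasDerivAt_iteratedDerivWithin (n := 2) hab (by exact_mod_cast hf) (k := 0)
      (by norm_num) ht
  · exact (hL t (Ioo_subset_Icc_self ht)).trans (le_max_left _ _)

/-- In a unimodular lattice without short vectors every point is close to the lattice. -/
theorem covering_radius_basis (d : ℕ) {δ : ℝ} (hδ : 0 < δ) :
    ∃ R : ℝ, 0 < R ∧ ∀ B : Module.Basis (Fin d) ℝ (Fin d → ℝ), |(Matrix.of ⇑B).det| = 1 →
      (∀ l ∈ Submodule.span ℤ (range B), l ≠ 0 → δ ≤ ‖l‖) →
      ∀ p : Fin d → ℝ, ∃ l ∈ Submodule.span ℤ (range B), dist p l < R := by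
  obtain ⟨N, hN⟩ := exists_nat_gt (1 / δ ^ d)
  have hN' : 1 < N * δ ^ d := (div_lt_iff₀ (by positivity)).1 hN
  have hN0 : (0 : ℝ) < N := lt_trans (by positivity) hN
  refine ⟨N * δ, by positivity, fun B hB hshort p => ?_⟩
  by_contra hfar
  push Not at hfar
  set L := Submodule.span ℤ (range B) with hL
  have hne : (L : Set (Fin d → ℝ)).Nonempty := ⟨0, L.zero_mem⟩
  have hinv : ∀ x, ∀ l ∈ L, Metric.infDist (l + x) (L : Set (Fin d → ℝ)) =
      Metric.infDist x (L : Set (Fin d → ℝ)) := by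
    intro x l hl
    have himg : (fun y => l + y) '' (L : Set (Fin d → ℝ)) = L := by
      ext y
      constructor
      · rintro ⟨z, hz, rfl⟩; exact L.add_mem hl hz
      · intro hy
        exact ⟨y - l, L.sub_mem hy hl, by simp⟩
    have := Metric.infDist_image (t := (L : Set (Fin d → ℝ))) (x := x) (isometry_add_left l)
    rwa [himg] at this
  have hcont : ContinuousOn (fun t : ℝ => Metric.infDist (t • p) (L : Set (Fin d → ℝ))) (Icc 0 1) :=
    ((Metric.continuous_infDist_pt _).comp (by fun_prop)).continuousOn
  have hivt := intermediate_value_Icc zero_le_one hcont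
  have hpt : ∀ m : Fin N, ∃ x, Metric.infDist x (L : Set (Fin d → ℝ)) = m * δ := by
    intro m
    suffices hm : (m : ℝ) * δ ∈ Icc (Metric.infDist ((0 : ℝ) • p) (L : Set (Fin d → ℝ)))
        (Metric.infDist ((1 : ℝ) • p) (L : Set (Fin d → ℝ))) by
      obtain ⟨t, -, ht⟩ := hivt hm
      exact ⟨_, ht⟩
    constructor
    · simp only [zero_smul]
      rw [Metric.infDist_zero_of_mem (by exact L.zero_mem)]
      positivity
    · simp only [one_smul]
      refine le_trans ?_ ((Metric.le_infDist hne).2 fun y hy => hfar y hy)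
      have : (m : ℝ) ≤ N := by exact_mod_cast m.2.le
      gcongr
  choose P hP using hpt
  have hsep : ∀ m m' : Fin N, ∀ l ∈ L, ∀ l' ∈ L, dist (l + P m) (l' + P m') < δ →
      m = m' ∧ l = l' := by
    intro m m' l hl l' hl' hlt
    have hmm : m = m' := by
      by_contra hne'
      have h1 := (Metric.lipschitz_infDist_pt (L : Set (Fin d → ℝ))).dist_le_mul (l + P m)
        (l' + P m')
      rw [NNReal.coe_one, one_mul, Real.dist_eq, hinv _ _ hl, hinv _ _ hl', hP, hP, ← sub_mul,
          abs_mul, abs_of_pos hδ] at h1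
      have h2 : (1 : ℝ) ≤ |(m : ℝ) - m'| := by
        have h3 : ((m : ℕ) : ℤ) - ((m' : ℕ) : ℤ) ≠ 0 := by
          intro h; exact hne' (Fin.ext (by omega))
        exact_mod_cast Int.one_le_abs h3
      nlinarith
    refine ⟨hmm, ?_⟩
    subst hmm
    rw [dist_add_right] at hlt
    by_contra hll
    have := hshort _ (L.sub_mem hl hl') (sub_ne_zero.2 hll)
    rw [dist_eq_norm] at hlt
    linarith
  set E : Set (Fin d → ℝ) := ⋃ m, Metric.ball (P m) (δ / 2) with hE
  have hEm : MeasurableSet E := MeasurableSet.iUnion fun m => Metric.isOpen_ball.measurableSet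
  have hEv : volume E = N * ENNReal.ofReal (δ ^ d) := by
    rw [hE, measure_iUnion]
    · have : ∀ m, volume (Metric.ball (P m) (δ / 2)) = ENNReal.ofReal (δ ^ d) := by
        intro m
        rw [Real.volume_pi_ball _ (by positivity), Fintype.card_fin, mul_div_cancel₀ _ two_ne_zero]
      simp [this]
    · intro m m' hmm
      refine Metric.ball_disjoint_ball ?_
      by_contra hlt
      push Not at hlt
      refine hmm (hsep m m' 0 L.zero_mem 0 L.zero_mem ?_).1
      simpa using hlt
    · exact fun m => Metric.isOpen_ball.measurableSet
  have hlt : volume (ZSpan.fundamentalDomain B) < volume E := by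
    rw [ZSpan.volume_fundamentalDomain, hB, hEv, ENNReal.ofReal_one, ← ENNReal.ofReal_natCast,
      ← ENNReal.ofReal_mul hN0.le]
    exact ENNReal.one_lt_ofReal.2 hN'
  have : Countable (Submodule.span ℤ (range B)).toAddSubgroup :=
    inferInstanceAs (Countable (Submodule.span ℤ (range B)))
  obtain ⟨x, y, hxy, hdisj⟩ := exists_pair_mem_lattice_not_disjoint_vadd
    (ZSpan.isAddFundamentalDomain' B volume) hEm.nullMeasurableSet hlt
  obtain ⟨z, hzx, hzy⟩ := Set.not_disjoint_iff.1 hdisj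
  obtain ⟨e, he, rfl⟩ := hzx
  obtain ⟨e', he', hee⟩ := hzy
  obtain ⟨m, hm⟩ := mem_iUnion.1 he
  obtain ⟨m', hm'⟩ := mem_iUnion.1 he'
  refine hxy (Subtype.ext (hsep m m' x x.2 y y.2 ?_).2)
  have hee' : (y : Fin d → ℝ) + e' = x + e := hee
  have h1 : dist ((x : Fin d → ℝ) + P m) (x + e) < δ / 2 := by
    rw [dist_add_left, dist_comm]; exact hm
  have h2 : dist ((x : Fin d → ℝ) + e) (y + P m') < δ / 2 := by
    rw [← hee', dist_add_left]; exact hm'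
  exact (dist_triangle _ _ _).trans_lt (by linarith)

theorem covering_radius (d : ℕ) {δ : ℝ} (hδ : 0 < δ) :
    ∃ R : ℝ, 0 < R ∧ ∀ M : Matrix (Fin d) (Fin d) ℝ, M.det = 1 →
      (∀ v : Fin d → ℤ, v ≠ 0 → δ ≤ ‖M.mulVec fun k => (v k : ℝ)‖) →
      ∀ p : Fin d → ℝ, ∃ v : Fin d → ℤ, ‖(M.mulVec fun k => (v k : ℝ)) - p‖ < R := by
  obtain ⟨R, hR, H⟩ := covering_radius_basis d hδ
  refine ⟨R, hR, fun M hM hshort p => ?_⟩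
  have hli : LinearIndependent ℝ M.col := by
    rw [Matrix.linearIndependent_cols_iff_isUnit, Matrix.isUnit_iff_isUnit_det, hM]
    exact isUnit_one
  set B : Module.Basis (Fin d) ℝ (Fin d → ℝ) := Module.Basis.mk hli
    (by rw [hli.span_eq_top_of_card_eq_finrank' (by simp)]) with hBdef
  have hB : ⇑B = M.col := by rw [hBdef, Module.Basis.coe_mk]
  have hmem : ∀ l ∈ Submodule.span ℤ (range B), ∃ v : Fin d → ℤ,
      (M.mulVec fun k => (v k : ℝ)) = l := by
    intro l hl
    obtain ⟨v, rfl⟩ := (Submodule.mem_span_range_iff_exists_fun ℤ).1 hl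
    refine ⟨v, ?_⟩
    ext i
    simp [hB, Matrix.mulVec, dotProduct, Finset.sum_apply, mul_comm]
  have hdet : |(Matrix.of ⇑B).det| = 1 := by
    have : Matrix.of ⇑B = M.transpose := by rw [hB]; rfl
    rw [this, Matrix.det_transpose, hM, abs_one]
  have hlong : ∀ l ∈ Submodule.span ℤ (range B), l ≠ 0 → δ ≤ ‖l‖ := by
    intro l hl hl0
    obtain ⟨v, rfl⟩ := hmem l hl
    refine hshort v ?_
    rintro rfl
    exact hl0 (by ext i; simp [Matrix.mulVec, dotProduct])
  obtain ⟨l, hl, hdist⟩ := H B hdet hlong p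
  obtain ⟨v, rfl⟩ := hmem l hl
  exact ⟨v, by rwa [← dist_eq_norm, dist_comm]⟩

theorem exists_root_of_deriv_ge {F F' : ℝ → ℝ} {y τ q : ℝ} (hτ : 0 ≤ τ)
    (hF : ∀ t ∈ Metric.closedBall y τ, HasDerivAt F (F' t) t)
    (hq : ∀ t ∈ Metric.closedBall y τ, q ≤ F' t) (hy : |F y| ≤ q * τ) :
    ∃ z ∈ Metric.closedBall y τ, F z = 0 := by
  rw [Real.closedBall_eq_Icc] at *
  have hcont : ContinuousOn F (Icc (y - τ) (y + τ)) :=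
    fun t ht => (hF t ht).continuousAt.continuousWithinAt
  have hmono := (convex_Icc (y - τ) (y + τ)).mul_sub_le_image_sub_of_le_deriv hcont
    (fun t ht => (hF t (interior_subset ht)).differentiableAt.differentiableWithinAt)
    (C := q) (fun t ht => by rw [(hF t (interior_subset ht)).deriv]; exact hq t (interior_subset ht))
  have h1 := hmono (y - τ) ⟨le_rfl, by linarith⟩ y ⟨by linarith, by linarith⟩ (by linarith)
  have h2 := hmono y ⟨by linarith, by linarith⟩ (y + τ) ⟨by linarith, le_rfl⟩ (by linarith)
  have h3 := abs_le.1 hy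
  obtain ⟨z, hz, hz0⟩ := intermediate_value_Icc (by linarith : y - τ ≤ y + τ) hcont
    (show (0 : ℝ) ∈ _ from ⟨by linarith, by linarith⟩)
  exact ⟨z, hz, hz0⟩

theorem UniformlyNondegenerate.exists_approximation {n : ℕ} {D : Fin n → ℕ → ℝ → ℝ} {U : Set ℝ}
    {A₁ A₂ : ℝ} (hn : 1 ≤ n) (h : UniformlyNondegenerate D U A₁ A₂) (hU : Convex ℝ U)
    {κ s : ℝ} {i₀ : Fin n} (hκ : 0 < κ) (hs : |s| = 1) (hκD : ∀ t ∈ U, κ ≤ s * D i₀ 1 t)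
    {lam lam' : ℝ → ℝ} {L : ℝ} (hL : 0 < L)
    (hlam : ∀ t ∈ U, HasDerivAt lam (lam' t) t ∧ |lam' t| ≤ L) {ε : ℝ} (hε : 0 < ε) :
    ∃ τ c₁ C₁ C₃ : ℝ, 0 < τ ∧ 0 < c₁ ∧ 0 < C₁ ∧ 0 < C₃ ∧ ∀ q : ℝ, 1 ≤ q → ∀ y : ℝ,
      Metric.closedBall y (τ / q ^ (n + 1)) ⊆ U →
      (∀ v : Fin (n + 1) → ℤ, v ≠ 0 →
        ε ≤ ‖(flowMatrix n q (liftCurve (fun i => D i 0) y)).mulVec fun k => (v k : ℝ)‖) →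
      ∃ (v : Fin n → ℤ) (v₀ : ℤ), ∃ z ∈ Metric.closedBall y (τ / q ^ (n + 1)),
        (∀ i, |(v i : ℝ)| ≤ C₁ * q) ∧ (∃ i, c₁ * q ≤ |(v i : ℝ)|) ∧
        ∀ t ∈ U, |v₀ + ∑ i, (v i : ℝ) * D i 0 t + lam t| ≤ C₃ * q * |t - z| := by
  classical
  obtain ⟨R, hR, HR⟩ := covering_radius (n + 1) hε
  have hA₂ := h.pos_upper
  set c₁ : ℝ := (1 + n * (R * A₂) + L) / κ with hc₁
  have hc₁0 : 0 < c₁ := by positivity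
  set M : ℝ := R + c₁ with hM
  have hM0 : 0 < M := by positivity
  have hs2 : s * s = 1 := by rw [← abs_mul_abs_self, hs, one_mul]
  refine ⟨R, c₁, M + R, n * ((M + R) * A₂) + L, hR, hc₁0, by positivity, by positivity, ?_⟩
  intro q hq y hyU hgood
  have hq0 : 0 < q := by linarith
  have hτ : 0 < R / q ^ (n + 1) := by positivity
  set Φ := flowMatrix n q (liftCurve (fun i => D i 0) y) with hΦ
  set w : Fin n → ℝ := Pi.single i₀ (s * M * q) with hw
  set p : Fin (n + 1) → ℝ := Fin.cons (-lam y - ∑ i, w i * D i 0 y) w with hp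
  obtain ⟨v, hv⟩ := HR Φ (flowMatrix_det n q hq0.ne' _ rfl) hgood (Φ.mulVec p)
  have hcoord : ∀ k, |Φ.mulVec (fun k => (v k : ℝ)) k - Φ.mulVec p k| < R := fun k =>
    (norm_le_pi_norm (Φ.mulVec (fun k => (v k : ℝ)) - Φ.mulVec p) k).trans_lt hv
  have hsucc : ∀ i : Fin n, |(v i.succ : ℝ) - w i| < R * q := by
    intro i
    have := hcoord i.succ
    rw [flowMatrix_mulVec_succ, flowMatrix_mulVec_succ, ← mul_sub, abs_mul,
      abs_of_pos (inv_pos.2 hq0), inv_mul_lt_iff₀ hq0] at this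
    simpa [hp, mul_comm] using this
  have hzero : |(v 0 : ℝ) + ∑ i : Fin n, (v i.succ : ℝ) * D i 0 y + lam y| * q ^ n < R := by
    have := hcoord 0
    rw [flowMatrix_mulVec_zero, flowMatrix_mulVec_zero,
      UniformlyNondegenerate.sum_liftCurve _ (fun k => (v k : ℝ)),
      UniformlyNondegenerate.sum_liftCurve, ← mul_sub, abs_mul,
      abs_of_pos (by positivity : 0 < q ^ n), mul_comm] at this
    simpa [hp] using this
  set u : Fin n → ℤ := fun i => v i.succ with hu
  have hwi : ∀ i ≠ i₀, w i = 0 := fun i hi => by simp [hw, hi]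
  have hwi₀ : w i₀ = s * M * q := by simp [hw]
  have habs : ∀ i, |(u i : ℝ)| ≤ (M + R) * q := by
    intro i
    have h1 := hsucc i
    have h2 : |w i| ≤ M * q := by
      by_cases hi : i = i₀
      · rw [hi, hwi₀, abs_mul, abs_mul, hs, abs_of_pos hM0, abs_of_pos hq0, one_mul]
      · rw [hwi i hi, abs_zero]; positivity
    have h3 := abs_sub_abs_le_abs_sub (v i.succ : ℝ) (w i)
    change |(v i.succ : ℝ)| ≤ _
    linarith
  have hbig : c₁ * q ≤ s * u i₀ := by
    have h1 := hsucc i₀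
    have h2 : |s * u i₀ - M * q| < R * q := by
      have : s * u i₀ - M * q = s * (v i₀.succ - w i₀) := by
        rw [hwi₀, hu]
        linear_combination (M * q) * hs2
      rwa [this, abs_mul, hs, one_mul]
    have h3 := (abs_lt.1 h2).1
    rw [hM] at h3
    linarith
  set F : ℝ → ℝ := fun t => v 0 + ∑ i, (u i : ℝ) * D i 0 t + lam t with hF
  set F' : ℝ → ℝ := fun t => ∑ i, (u i : ℝ) * D i 1 t + lam' t with hF'
  have hderiv : ∀ t ∈ U, HasDerivAt F (F' t) t := by
    intro t ht
    refine HasDerivAt.add (HasDerivAt.const_add _ (HasDerivAt.fun_sum fun i _ => ?_)) (hlam t ht).1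
    exact (h.hasDerivAt i 0 hn t ht).const_mul _
  have hlow : ∀ t ∈ U, q ≤ F' t := by
    intro t ht
    have h1 : |∑ i ∈ Finset.univ.erase i₀, (u i : ℝ) * D i 1 t| ≤ n * (R * A₂) * q := by
      refine (Finset.abs_sum_le_sum_abs _ _).trans ?_
      refine (Finset.sum_le_card_nsmul _ _ (R * q * A₂) fun i hi => ?_).trans ?_
      · have h2 := (hsucc i).le
        rw [hwi i (Finset.ne_of_mem_erase hi), sub_zero] at h2
        rw [abs_mul]
        exact mul_le_mul h2 (h.abs_coord_le i hn ht) (abs_nonneg _) (by positivity)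
      · rw [nsmul_eq_mul]
        have : ((Finset.univ.erase i₀).card : ℝ) ≤ n := by
          have := Finset.card_erase_le (s := Finset.univ) (a := i₀)
          rw [Finset.card_univ, Fintype.card_fin] at this
          exact_mod_cast this
        calc _ ≤ (n : ℝ) * (R * q * A₂) := by gcongr
          _ = _ := by ring
    have h3 : c₁ * q * κ ≤ u i₀ * D i₀ 1 t := by
      have : (u i₀ : ℝ) * D i₀ 1 t = (s * u i₀) * (s * D i₀ 1 t) := by
        linear_combination (-(u i₀ : ℝ) * D i₀ 1 t) * hs2
      rw [this]
      exact mul_le_mul hbig (hκD t ht) hκ.le ((by positivity : (0 : ℝ) ≤ c₁ * q).trans hbig)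
    have h4 : c₁ * q * κ = (1 + n * (R * A₂) + L) * q := by
      rw [hc₁]; field_simp
    have h5 := (abs_le.1 (hlam t ht).2).1
    have h6 := (abs_le.1 h1).1
    have h7 : F' t = u i₀ * D i₀ 1 t + ∑ i ∈ Finset.univ.erase i₀, (u i : ℝ) * D i 1 t + lam' t := by
      rw [Finset.add_sum_erase _ (fun i => (u i : ℝ) * D i 1 t) (Finset.mem_univ i₀)]
    have h8 : L ≤ L * q := le_mul_of_one_le_right hL.le hq
    rw [h7]
    nlinarith
  have hup : ∀ t ∈ U, |F' t| ≤ (n * ((M + R) * A₂) + L) * q := by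
    intro t ht
    have h1 : |∑ i, (u i : ℝ) * D i 1 t| ≤ n * ((M + R) * q * A₂) := by
      refine (Finset.abs_sum_le_sum_abs _ _).trans ?_
      refine (Finset.sum_le_card_nsmul _ _ ((M + R) * q * A₂) fun i _ => ?_).trans (by simp)
      rw [abs_mul]
      exact mul_le_mul (habs i) (h.abs_coord_le i hn ht) (abs_nonneg _) (by positivity)
    have h8 : L ≤ L * q := le_mul_of_one_le_right hL.le hq
    refine (abs_add_le _ _).trans ?_
    have := (hlam t ht).2
    linarith
  obtain ⟨z, hz, hz0⟩ := exists_root_of_deriv_ge (F := F) (F' := F') hτ.le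
    (fun t ht => hderiv t (hyU ht)) (fun t ht => hlow t (hyU ht)) (by
      have h1 : |F y| ≤ R / q ^ n := (le_div_iff₀ (by positivity)).2 hzero.le
      refine h1.trans (le_of_eq ?_)
      rw [pow_succ]
      field_simp)
  refine ⟨u, v 0, z, hz, habs, ⟨i₀, ?_⟩, fun t ht => ?_⟩
  · refine hbig.trans ((le_abs_self _).trans ?_)
    rw [abs_mul, hs, one_mul]
  · have := hU.norm_image_sub_le_of_norm_hasDerivWithin_le (f := F) (f' := F')
      (fun t ht => (hderiv t ht).hasDerivWithinAt) (fun t ht => hup t ht) (hyU hz) ht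
    rw [hz0, sub_zero] at this
    exact this

theorem second_moment {ι : Type*} (μ : Measure ℝ) [IsFiniteMeasure μ] (s : Finset ι)
    (E : ι → Set ℝ) (hE : ∀ i ∈ s, MeasurableSet (E i)) (u : ℝ) :
    0 ≤ ∑ i ∈ s, ∑ j ∈ s, μ.real (E i ∩ E j) - 2 * u * ∑ i ∈ s, μ.real (E i) +
      u ^ 2 * μ.real (⋃ i ∈ s, E i) := by
  classical
  set B := ⋃ i ∈ s, E i with hB
  have hBm : MeasurableSet B := Finset.measurableSet_biUnion s hE
  have hind : ∀ A : Set ℝ, MeasurableSet A → Integrable (A.indicator (1 : ℝ → ℝ)) μ :=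
    fun A hA => (integrable_const (1 : ℝ)).indicator hA
  have hval : ∀ A : Set ℝ, MeasurableSet A → ∫ x, A.indicator (1 : ℝ → ℝ) x ∂μ = μ.real A :=
    fun A hA => integral_indicator_one hA
  have hpt : ∀ x, (∑ i ∈ s, (E i).indicator (1 : ℝ → ℝ) x - u * B.indicator 1 x) ^ 2 =
      ∑ i ∈ s, ∑ j ∈ s, (E i ∩ E j).indicator (1 : ℝ → ℝ) x
        - 2 * u * ∑ i ∈ s, (E i).indicator (1 : ℝ → ℝ) x + u ^ 2 * B.indicator (1 : ℝ → ℝ) x := by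
    intro x
    have h1 : ∀ i ∈ s, (E i).indicator (1 : ℝ → ℝ) x * B.indicator 1 x =
        (E i).indicator (1 : ℝ → ℝ) x := by
      intro i hi
      by_cases hx : x ∈ E i
      · have : x ∈ B := mem_biUnion (show i ∈ (s : Set ι) from hi) hx
        simp [hx, this]
      · simp [hx]
    have h2 : (∑ i ∈ s, (E i).indicator (1 : ℝ → ℝ) x) * B.indicator 1 x =
        ∑ i ∈ s, (E i).indicator (1 : ℝ → ℝ) x := by
      rw [Finset.sum_mul]; exact Finset.sum_congr rfl h1
    have h3 : B.indicator (1 : ℝ → ℝ) x * B.indicator (1 : ℝ → ℝ) x = B.indicator 1 x := by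
      by_cases hx : x ∈ B <;> simp [hx]
    have h4 : ∑ i ∈ s, ∑ j ∈ s, (E i ∩ E j).indicator (1 : ℝ → ℝ) x =
        (∑ i ∈ s, (E i).indicator (1 : ℝ → ℝ) x) * ∑ i ∈ s, (E i).indicator (1 : ℝ → ℝ) x := by
      rw [Finset.sum_mul_sum]
      refine Finset.sum_congr rfl fun i _ => Finset.sum_congr rfl fun j _ => ?_
      rw [Set.inter_indicator_one]
      rfl
    rw [h4]
    linear_combination (-2 * u) * h2 + u ^ 2 * h3
  have hint := integral_nonneg (μ := μ)
    (f := fun x => (∑ i ∈ s, (E i).indicator (1 : ℝ → ℝ) x - u * B.indicator 1 x) ^ 2)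
    (fun x => sq_nonneg _)
  have i1 : Integrable (fun x => ∑ i ∈ s, ∑ j ∈ s, (E i ∩ E j).indicator (1 : ℝ → ℝ) x) μ :=
    integrable_finsetSum _ fun i hi => integrable_finsetSum _ fun j hj =>
      hind _ ((hE i hi).inter (hE j hj))
  have i2 : Integrable (fun x => 2 * u * ∑ i ∈ s, (E i).indicator (1 : ℝ → ℝ) x) μ :=
    (integrable_finsetSum _ fun i hi => hind _ (hE i hi)).const_mul _
  have i3 : Integrable (fun x => u ^ 2 * B.indicator (1 : ℝ → ℝ) x) μ := (hind _ hBm).const_mul _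
  simp_rw [hpt] at hint
  have i12 : Integrable (fun x => ∑ i ∈ s, ∑ j ∈ s, (E i ∩ E j).indicator (1 : ℝ → ℝ) x -
      2 * u * ∑ i ∈ s, (E i).indicator (1 : ℝ → ℝ) x) μ := i1.sub i2
  rw [integral_add i12 i3, integral_sub i1 i2, integral_const_mul, integral_const_mul,
    hval B hBm, integral_finsetSum _ fun i hi => hind _ (hE i hi),
    integral_finsetSum _ fun i hi => integrable_finsetSum _ fun j hj =>
      hind _ ((hE i hi).inter (hE j hj))] at hint
  have e1 : ∑ i ∈ s, ∫ x, (E i).indicator (1 : ℝ → ℝ) x ∂μ = ∑ i ∈ s, μ.real (E i) :=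
    Finset.sum_congr rfl fun i hi => hval _ (hE i hi)
  have e2 : ∑ i ∈ s, ∫ x, ∑ j ∈ s, (E i ∩ E j).indicator (1 : ℝ → ℝ) x ∂μ =
      ∑ i ∈ s, ∑ j ∈ s, μ.real (E i ∩ E j) := by
    refine Finset.sum_congr rfl fun i hi => ?_
    rw [integral_finsetSum _ fun j hj => hind _ ((hE i hi).inter (hE j hj))]
    exact Finset.sum_congr rfl fun j hj => hval _ ((hE i hi).inter (hE j hj))
  rw [e1, e2] at hint
  exact hint

theorem sum_geometric_gap_le (t : ℕ → ℝ) (ht : ∀ k, 0 ≤ t k) (s : Finset ℕ) :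
    ∑ k ∈ s, ∑ l ∈ s, (if k < l then (1 / 2 : ℝ) ^ (l - k) * t l else 0) ≤ ∑ l ∈ s, t l := by
  rw [Finset.sum_comm]
  refine Finset.sum_le_sum fun l _ => ?_
  have h1 : ∀ N : ℕ, ∑ k ∈ Finset.range N, (1 / 2 : ℝ) ^ (k + 1) ≤ 1 := by
    intro N
    have : ∀ N : ℕ, ∑ k ∈ Finset.range N, (1 / 2 : ℝ) ^ (k + 1) = 1 - (1 / 2) ^ N := by
      intro N
      induction N with
      | zero => simp
      | succ N ih => rw [Finset.sum_range_succ, ih]; ring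
    rw [this]
    have : (0 : ℝ) ≤ (1 / 2) ^ N := by positivity
    linarith
  rw [← Finset.sum_filter, ← Finset.sum_mul]
  refine mul_le_of_le_one_left (ht l) ?_
  refine le_trans ?_ (h1 l)
  rw [← Finset.sum_range_reflect]
  have hsub : s.filter (fun k => k < l) ⊆ Finset.range l := by
    intro k hk
    exact Finset.mem_range.2 (Finset.mem_filter.1 hk).2
  refine (Finset.sum_le_sum_of_subset_of_nonneg hsub fun _ _ _ => by positivity).trans ?_
  refine (Finset.sum_congr rfl fun k hk => ?_).le
  have := Finset.mem_range.1 hk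
  congr 1
  omega

/-- A quantitative divergence Borel-Cantelli lemma for quasi-independent sets. -/
theorem measure_limsup_ge (μ : Measure ℝ) [IsFiniteMeasure μ] (E : ℕ → Set ℝ)
    (hE : ∀ k, MeasurableSet (E k)) (t : ℕ → ℝ) (ht : ∀ k, 0 ≤ t k) (htd : ¬ Summable t) (K : ℕ)
    {α β : ℝ} (hα : 0 < α) (hβ : 0 < β) (hlow : ∀ k ≥ K, α * t k ≤ μ.real (E k))
    (hup : ∀ k ≥ K, μ.real (E k) ≤ β * t k)
    (hinter : ∀ k ≥ K, ∀ l > k, μ.real (E k ∩ E l) ≤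
      β * (t k * t l + (1 / 2) ^ (l - k) * t l)) :
    ENNReal.ofReal (α ^ 2 / (2 * β)) ≤ μ (limsup E atTop) := by
  have htail : ∀ N ≥ K, ENNReal.ofReal (α ^ 2 / (2 * β)) ≤ μ (⋃ k ≥ N, E k) := by
    intro N hN
    have hdiv := (not_summable_iff_tendsto_nat_atTop_of_nonneg ht).1 htd
    obtain ⟨N', hN'⟩ := (hdiv.eventually_ge_atTop (3 + ∑ k ∈ Finset.range N, t k)).exists
    set s := Finset.range N' \ Finset.range N with hs
    have hsN : ∀ k ∈ s, N ≤ k := fun k hk => by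
      have := (Finset.mem_sdiff.1 hk).2
      simpa using this
    set T := ∑ k ∈ s, t k with hT
    have hT3 : 3 ≤ T := by
      have h1 : ∑ k ∈ Finset.range N', t k ≤ T + ∑ k ∈ Finset.range N, t k := by
        rw [hT, ← Finset.sum_union Finset.sdiff_disjoint]
        refine Finset.sum_le_sum_of_subset_of_nonneg ?_ fun k _ _ => ht k
        rw [Finset.sdiff_union_self_eq_union]
        exact Finset.subset_union_left
      linarith
    set S1 := ∑ k ∈ s, μ.real (E k) with hS1
    have hS1l : α * T ≤ S1 := by
      rw [hT, Finset.mul_sum]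
      exact Finset.sum_le_sum fun k hk => hlow k (hN.trans (hsN k hk))
    set S2 := ∑ k ∈ s, ∑ l ∈ s, μ.real (E k ∩ E l) with hS2
    have hS2u : S2 ≤ β * (T ^ 2 + 3 * T) := by
      set G : ℕ → ℕ → ℝ := fun k l => if k < l then (1 / 2 : ℝ) ^ (l - k) * t l else 0 with hG
      have hG0 : ∀ k l, 0 ≤ G k l := by
        intro k l
        simp only [hG]
        split_ifs
        · have := ht l; positivity
        · exact le_rfl
      have hpt : ∀ k ∈ s, ∀ l ∈ s, μ.real (E k ∩ E l) ≤
          β * (t k * t l + (G k l + G l k + if k = l then t l else 0)) := by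
        intro k hk l hl
        have hkK := hN.trans (hsN k hk)
        have hlK := hN.trans (hsN l hl)
        rcases lt_trichotomy k l with hkl | hkl | hkl
        · have h1 := hinter k hkK l hkl
          simpa [hG, hkl, hkl.not_gt, hkl.ne] using h1
        · subst hkl
          rw [inter_self]
          refine (hup k hkK).trans ?_
          have := mul_nonneg (ht k) (ht k)
          simp only [hG, lt_irrefl, if_false, if_true]
          nlinarith
        · have h1 := hinter l hlK k hkl
          rw [inter_comm]
          simpa [hG, hkl, hkl.not_gt, hkl.ne', mul_comm (t l)] using h1
      have hsum : S2 ≤ ∑ k ∈ s, ∑ l ∈ s,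
          β * (t k * t l + (G k l + G l k + if k = l then t l else 0)) :=
        Finset.sum_le_sum fun k hk => Finset.sum_le_sum fun l hl => hpt k hk l hl
      have hGs : ∑ k ∈ s, ∑ l ∈ s, G k l ≤ T := sum_geometric_gap_le t ht s
      have hGs' : ∑ k ∈ s, ∑ l ∈ s, G l k ≤ T := by rw [Finset.sum_comm]; exact hGs
      have hdiag : ∑ k ∈ s, ∑ l ∈ s, (if k = l then t l else 0) = T := by
        refine Finset.sum_congr rfl fun k hk => ?_
        rw [Finset.sum_ite_eq, if_pos hk]
      have hprod : ∑ k ∈ s, ∑ l ∈ s, t k * t l = T ^ 2 := by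
        rw [sq, hT, Finset.sum_mul_sum]
      simp only [← Finset.mul_sum, Finset.sum_add_distrib] at hsum
      simp only [← Finset.mul_sum] at hprod
      rw [hprod, hdiag] at hsum
      refine hsum.trans ?_
      gcongr
      linarith
    set m := μ.real (⋃ k ∈ s, E k) with hm
    have hS1p : 0 < S1 := lt_of_lt_of_le (by positivity) hS1l
    have hTp : 0 < T := by linarith
    have hm0 : 0 ≤ m := measureReal_nonneg
    have hquad := second_moment μ s E (fun k _ => hE k) (β * (T ^ 2 + 3 * T) / S1)
    rw [← hS1, ← hS2, ← hm] at hquad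
    set X := β * (T ^ 2 + 3 * T) with hX
    have hXp : 0 < X := by positivity
    have h2 : 2 * (X / S1) * S1 = 2 * X := by field_simp
    rw [h2] at hquad
    have h3 : X ≤ (X / S1) ^ 2 * m := by linarith
    have h4 : S1 ^ 2 ≤ X * m := by
      rw [div_pow, div_mul_eq_mul_div, le_div_iff₀ (by positivity)] at h3
      nlinarith
    have h5 : α ^ 2 / (2 * β) ≤ m := by
      rw [div_le_iff₀ (by positivity)]
      have h6 : (α * T) ^ 2 ≤ S1 ^ 2 := by gcongr
      have h7 : X ≤ β * (2 * T ^ 2) := by rw [hX]; gcongr; nlinarith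
      have h8 : X * m ≤ β * (2 * T ^ 2) * m := by gcongr
      have h9 : α ^ 2 * T ^ 2 ≤ (m * (2 * β)) * T ^ 2 := by nlinarith
      exact le_of_mul_le_mul_right h9 (by positivity)
    calc ENNReal.ofReal (α ^ 2 / (2 * β)) ≤ ENNReal.ofReal m := ENNReal.ofReal_le_ofReal h5
      _ = μ (⋃ k ∈ s, E k) := by rw [hm, ofReal_measureReal (measure_ne_top _ _)]
      _ ≤ μ (⋃ k ≥ N, E k) :=
        measure_mono (biUnion_subset_biUnion_left fun k hk => hsN k hk)
  rw [limsup_eq_iInf_iSup_of_nat]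
  simp only [iSup_eq_iUnion, iInf_eq_iInter]
  have hanti : Antitone fun N => ⋃ k ≥ N, E k := fun N N' h =>
    biUnion_subset_biUnion_left fun k hk => le_trans h hk
  rw [hanti.measure_iInter
    (fun N => (MeasurableSet.biUnion (to_countable _) fun k _ => hE k).nullMeasurableSet)
    ⟨0, measure_ne_top _ _⟩]
  refine le_iInf fun N => ?_
  exact (htail (max N K) (le_max_right _ _)).trans (measure_mono (hanti (le_max_left _ _)))

theorem volume_biUnion_balls {ι : Type*} (s : Finset ι) (g : ι → ℝ) {δ ρ : ℝ} (hρ : ρ ≤ δ)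
    (hsep : ∀ z ∈ s, ∀ w ∈ s, z ≠ w → 2 * δ ≤ |g z - g w|) :
    volume (⋃ z ∈ s, Metric.ball (g z) ρ) = s.card * ENNReal.ofReal (2 * ρ) := by
  rw [measure_biUnion_finset]
  · simp [Real.volume_ball]
  · intro z hz w hw hzw
    refine Metric.ball_disjoint_ball ?_
    have := hsep z hz w hw hzw
    rw [Real.dist_eq]
    linarith
  · exact fun z _ => Metric.isOpen_ball.measurableSet

theorem card_separated_mul_le (s : Finset ℝ) {x ρ δ : ℝ} (hρ : 0 ≤ ρ) (hδ : 0 < δ)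
    (hsep : ∀ z ∈ s, ∀ w ∈ s, z ≠ w → 2 * δ ≤ |z - w|)
    (hs : ∀ z ∈ s, |z - x| ≤ ρ) : (s.card : ℝ) * δ ≤ ρ + δ := by
  have h1 := volume_biUnion_balls s id le_rfl hsep
  have h2 : (⋃ z ∈ s, Metric.ball (id z) δ) ⊆ Metric.closedBall x (ρ + δ) := by
    refine iUnion₂_subset fun z hz y hy => ?_
    have h3 := hs z hz
    rw [Metric.mem_ball, Real.dist_eq, id] at hy
    rw [Metric.mem_closedBall, Real.dist_eq]
    calc |y - x| ≤ |y - z| + |z - x| := abs_sub_le _ _ _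
      _ ≤ ρ + δ := by linarith
  have h3 := measure_mono (μ := volume) h2
  rw [h1, Real.volume_closedBall, ← ENNReal.ofReal_natCast, ← ENNReal.ofReal_mul (by positivity),
    ENNReal.ofReal_le_ofReal_iff (by positivity)] at h3
  nlinarith

theorem exists_maximal_separated {W : Set ℝ} {x ρ δ : ℝ} (hρ : 0 ≤ ρ) (hδ : 0 < δ)
    (hW : ∀ z ∈ W, |z - x| ≤ ρ) :
    ∃ s : Finset ℝ, (∀ z ∈ s, z ∈ W) ∧ (∀ z ∈ s, ∀ w ∈ s, z ≠ w → 2 * δ ≤ |z - w|) ∧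
      ∀ z ∈ W, ∃ w ∈ s, |z - w| < 2 * δ := by
  by_contra! hcon
  have hall : ∀ N : ℕ, ∃ s : Finset ℝ, s.card = N ∧ (∀ z ∈ s, z ∈ W) ∧
      ∀ z ∈ s, ∀ w ∈ s, z ≠ w → 2 * δ ≤ |z - w| := by
    intro N
    induction N with
    | zero => exact ⟨∅, by simp⟩
    | succ N ih =>
      obtain ⟨s, hc, hsW, hsep⟩ := ih
      obtain ⟨z, hz, hzs⟩ := hcon s hsW hsep
      have hzn : z ∉ s := by
        intro h
        have := hzs z h
        rw [sub_self, abs_zero] at this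
        linarith
      refine ⟨insert z s, by rw [Finset.card_insert_of_notMem hzn, hc], ?_, ?_⟩
      · intro w hw
        rcases Finset.mem_insert.1 hw with rfl | h
        · exact hz
        · exact hsW w h
      · intro w hw w' hw' hne
        rcases Finset.mem_insert.1 hw with rfl | h <;>
          rcases Finset.mem_insert.1 hw' with rfl | h'
        · exact absurd rfl hne
        · exact hzs w' h'
        · rw [abs_sub_comm]; exact hzs w h
        · exact hsep w h w' h' hne
  obtain ⟨N, hN⟩ := exists_nat_gt ((ρ + δ) / δ)
  obtain ⟨s, hc, hsW, hsep⟩ := hall N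
  have h1 := card_separated_mul_le s hρ hδ hsep fun z hz => hW z (hsW z hz)
  rw [div_lt_iff₀ hδ] at hN
  rw [hc] at h1
  linarith

/-- A local ubiquity statement: neighbourhoods of radius `t k * θ ^ k` of points which are
`θ ^ k`-dense in a large part of an interval have a limsup set of comparable measure. -/
theorem volume_limsup_neighborhoods_ge (Z : ℕ → Set ℝ) {c r R₀ θ : ℝ} (hr : 0 < r) (hR : 0 < R₀)
    (hθ : 0 < θ) (hθ2 : θ ≤ 1 / 2) (t : ℕ → ℝ) (ht : ∀ k, 0 < t k) (ht1 : ∀ k, t k ≤ 1)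
    (htd : ¬ Summable t) (K : ℕ)
    (hZ : ∀ k ≥ K, ENNReal.ofReal r ≤
      volume {y ∈ Metric.closedBall c r | ∃ z ∈ Z k, |y - z| ≤ R₀ * θ ^ k}) :
    ENNReal.ofReal (r / (24 * (R₀ + 2) ^ 2)) ≤
      volume (Metric.closedBall c (3 * r) ∩
        limsup (fun k => ⋃ z ∈ Z k, Metric.ball z (t k * θ ^ k)) atTop) := by
  have hσ : ∀ k, 0 < θ ^ k := fun k => pow_pos hθ k
  have hW : ∀ k, ∀ z ∈ Z k ∩ Metric.closedBall c (2 * r), |z - c| ≤ 2 * r := fun k z hz => by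
    have := hz.2
    rwa [Metric.mem_closedBall, Real.dist_eq] at this
  choose S hSW hsep hmax using fun k =>
    exists_maximal_separated (by positivity : 0 ≤ 2 * r) (hσ k) (hW k)
  obtain ⟨K', hK'⟩ : ∃ K', ∀ k ≥ K', R₀ * θ ^ k ≤ r ∧ θ ^ k ≤ r := by
    have hlim := tendsto_pow_atTop_nhds_zero_of_lt_one hθ.le (by linarith)
    have h1 := (hlim.const_mul R₀).eventually_le_const (by simpa using hr)
    have h2 := hlim.eventually_le_const hr
    exact eventually_atTop.1 (h1.and h2)
  set ρ : ℕ → ℝ := fun k => t k * θ ^ k with hρdef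
  have hρp : ∀ k, 0 < ρ k := fun k => mul_pos (ht k) (hσ k)
  have hρσ : ∀ k, ρ k ≤ θ ^ k := fun k => mul_le_of_le_one_left (hσ k).le (ht1 k)
  set E : ℕ → Set ℝ := fun k => ⋃ z ∈ S k, Metric.ball z (ρ k) with hE
  have hEm : ∀ k, MeasurableSet (E k) := fun k =>
    Finset.measurableSet_biUnion _ fun z _ => Metric.isOpen_ball.measurableSet
  have hEsub : ∀ k ≥ K', E k ⊆ Metric.closedBall c (3 * r) := by
    intro k hk
    refine iUnion₂_subset fun z hz y hy => ?_
    rw [Metric.mem_ball, Real.dist_eq] at hy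
    rw [Metric.mem_closedBall, Real.dist_eq]
    have h1 := hW k z (hSW k z hz)
    calc |y - c| ≤ |y - z| + |z - c| := abs_sub_le _ _ _
      _ ≤ 3 * r := by have := hρσ k; have := (hK' k hk).2; linarith
  have hvol : ∀ k, volume (E k) = (S k).card * ENNReal.ofReal (2 * ρ k) := fun k =>
    volume_biUnion_balls (S k) id (hρσ k) (hsep k)
  set μ := volume.restrict (Metric.closedBall c (3 * r)) with hμ
  have : IsFiniteMeasure μ := ⟨by
    rw [hμ, Measure.restrict_apply_univ, Real.volume_closedBall]; exact ENNReal.ofReal_lt_top⟩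
  have hμE : ∀ k ≥ K', μ.real (E k) = 2 * ((S k).card * θ ^ k) * t k := by
    intro k hk
    rw [Measure.real, hμ, Measure.restrict_eq_self _ (hEsub k hk), hvol, ENNReal.toReal_mul,
      ENNReal.toReal_natCast, ENNReal.toReal_ofReal (by have := hρp k; positivity)]
    simp only [hρdef]
    ring
  have hcard : ∀ k ≥ K', ((S k).card : ℝ) * θ ^ k ≤ 3 * r := by
    intro k hk
    have := card_separated_mul_le (S k) (by positivity : 0 ≤ 2 * r) (hσ k) (hsep k)
      fun z hz => hW k z (hSW k z hz)
    have := (hK' k hk).2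
    linarith
  have hcard2 : ∀ k ≥ max K K', r ≤ 2 * (R₀ + 2) * ((S k).card * θ ^ k) := by
    intro k hk
    have hk1 := (le_max_left K K').trans hk
    have hk2 := (le_max_right K K').trans hk
    have hsub : {y ∈ Metric.closedBall c r | ∃ z ∈ Z k, |y - z| ≤ R₀ * θ ^ k} ⊆
        ⋃ w ∈ S k, Metric.closedBall w ((R₀ + 2) * θ ^ k) := by
      rintro y ⟨hy, z, hz, hyz⟩
      rw [Metric.mem_closedBall, Real.dist_eq] at hy
      have hzc : z ∈ Metric.closedBall c (2 * r) := by
        rw [Metric.mem_closedBall, Real.dist_eq]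
        calc |z - c| ≤ |z - y| + |y - c| := abs_sub_le _ _ _
          _ ≤ 2 * r := by rw [abs_sub_comm]; have := (hK' k hk2).1; linarith
      obtain ⟨w, hw, hzw⟩ := hmax k z ⟨hz, hzc⟩
      refine mem_biUnion (show w ∈ (S k : Set ℝ) from hw) ?_
      rw [Metric.mem_closedBall, Real.dist_eq]
      calc |y - w| ≤ |y - z| + |z - w| := abs_sub_le _ _ _
        _ ≤ (R₀ + 2) * θ ^ k := by linarith
    have h1 := (hZ k hk1).trans ((measure_mono hsub).trans (measure_biUnion_finset_le _ _))
    simp only [Real.volume_closedBall, Finset.sum_const, nsmul_eq_mul] at h1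
    rw [← ENNReal.ofReal_natCast, ← ENNReal.ofReal_mul (by positivity),
      ENNReal.ofReal_le_ofReal_iff (by have := hσ k; positivity)] at h1
    linarith
  have hinter : ∀ k ≥ K', ∀ l > k, μ.real (E k ∩ E l) ≤
      12 * r * (t k * t l + (1 / 2) ^ (l - k) * t l) := by
    classical
    intro k hk l hkl
    have hsub : E k ∩ E l ⊆ ⋃ z ∈ S k, ⋃ w ∈ (S l).filter (fun w => |w - z| ≤ ρ k + ρ l),
        Metric.ball w (ρ l) := by
      rintro y ⟨hy1, hy2⟩
      obtain ⟨z, hz, hyz⟩ := mem_iUnion₂.1 hy1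
      obtain ⟨w, hw, hyw⟩ := mem_iUnion₂.1 hy2
      refine mem_iUnion₂.2 ⟨z, hz, mem_iUnion₂.2 ⟨w, Finset.mem_filter.2 ⟨hw, ?_⟩, hyw⟩⟩
      rw [Metric.mem_ball, Real.dist_eq] at hyz hyw
      calc |w - z| ≤ |w - y| + |y - z| := abs_sub_le _ _ _
        _ ≤ ρ k + ρ l := by rw [abs_sub_comm w y]; linarith
    have hball : ∀ w, μ.real (Metric.ball w (ρ l)) ≤ 2 * ρ l := by
      intro w
      have h1 : μ (Metric.ball w (ρ l)) ≤ ENNReal.ofReal (2 * ρ l) := by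
        rw [← Real.volume_ball w]; exact Measure.restrict_apply_le _ _
      exact ENNReal.toReal_le_of_le_ofReal (by have := hρp l; positivity) h1
    have hin : ∀ z ∈ S k, μ.real (⋃ w ∈ (S l).filter (fun w => |w - z| ≤ ρ k + ρ l),
        Metric.ball w (ρ l)) ≤ 2 * t l * (ρ k + 2 * θ ^ l) := by
      intro z _
      have h1 := card_separated_mul_le ((S l).filter (fun w => |w - z| ≤ ρ k + ρ l))
        (x := z) (ρ := ρ k + ρ l) (by have := hρp k; have := hρp l; positivity) (hσ l)
        (fun z hz w hw => hsep l z (Finset.mem_filter.1 hz).1 w (Finset.mem_filter.1 hw).1)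
        (fun w hw => (Finset.mem_filter.1 hw).2)
      have h2 := measureReal_biUnion_finset_le (μ := μ)
        ((S l).filter (fun w => |w - z| ≤ ρ k + ρ l)) (fun w => Metric.ball w (ρ l))
      refine h2.trans ((Finset.sum_le_sum fun w _ => hball w).trans ?_)
      rw [Finset.sum_const, nsmul_eq_mul]
      have h3 := hρσ l
      have h4 : ((S l).filter (fun w => |w - z| ≤ ρ k + ρ l)).card * θ ^ l ≤ ρ k + 2 * θ ^ l := by
        linarith
      calc _ = 2 * t l * (((S l).filter (fun w => |w - z| ≤ ρ k + ρ l)).card * θ ^ l) := by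
            simp only [hρdef]; ring
        _ ≤ _ := by have := (ht l).le; gcongr
    have h1 : μ.real (E k ∩ E l) ≤ (S k).card * (2 * t l * (ρ k + 2 * θ ^ l)) := by
      refine (measureReal_mono hsub (measure_ne_top _ _)).trans
        ((measureReal_biUnion_finset_le _ _).trans ?_)
      refine (Finset.sum_le_sum hin).trans ?_
      rw [Finset.sum_const, nsmul_eq_mul]
    have h2 : θ ^ l ≤ θ ^ k * (1 / 2) ^ (l - k) := by
      have : l = k + (l - k) := by omega
      rw [this, pow_add, Nat.add_sub_cancel_left]
      have := hσ k
      gcongr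
    have hc := hcard k hk
    have htl := ht l
    have htk := ht k
    calc μ.real (E k ∩ E l) ≤ (S k).card * (2 * t l * (ρ k + 2 * θ ^ l)) := h1
      _ ≤ (S k).card * (2 * t l * (t k * θ ^ k + 2 * (θ ^ k * (1 / 2) ^ (l - k)))) := by gcongr
      _ = (S k).card * θ ^ k * (2 * t l * (t k + 2 * (1 / 2) ^ (l - k))) := by ring
      _ ≤ 3 * r * (2 * t l * (t k + 2 * (1 / 2) ^ (l - k))) := by gcongr
      _ ≤ 3 * r * (2 * t l * (2 * t k + 2 * (1 / 2) ^ (l - k))) := by gcongr; linarith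
      _ = _ := by ring
  have hmain := measure_limsup_ge μ E hEm t (fun k => (ht k).le) htd (max K K')
    (α := r / (R₀ + 2)) (β := 12 * r) (by positivity) (by positivity)
    (fun k hk => by
      have h1 := hcard2 k hk
      rw [hμE k ((le_max_right K K').trans hk)]
      have := (ht k).le
      gcongr
      rw [div_le_iff₀ (by positivity)]
      linarith)
    (fun k hk => by
      have hk' := (le_max_right K K').trans hk
      have h1 := hcard k hk'
      rw [hμE k hk']
      exact mul_le_mul_of_nonneg_right (by linarith) (ht k).le)
    (fun k hk l hl => hinter k ((le_max_right K K').trans hk) l hl)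
  have harith : (r / (R₀ + 2)) ^ 2 / (2 * (12 * r)) = r / (24 * (R₀ + 2) ^ 2) := by
    field_simp
    ring
  rw [harith] at hmain
  refine hmain.trans ?_
  rw [hμ, Measure.restrict_apply (MeasurableSet.measurableSet_limsup hEm), inter_comm]
  refine measure_mono (inter_subset_inter_right _ ?_)
  refine limsup_le_limsup (Eventually.of_forall fun k => ?_)
  exact biUnion_subset_biUnion_left fun z hz => (hSW k z hz).1

theorem summable_of_summable_dyadic {n : ℕ} (hn : 1 ≤ n) {ψ : ℝ → ℝ}
    (hψpos : ∀ q : ℝ, 0 < q → 0 < ψ q) (hψdec : AntitoneOn ψ (Ioi 0))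
    (h : Summable fun k : ℕ => (2 : ℝ) ^ (k * n) * ψ (2 ^ k)) :
    Summable fun h : ℕ => ((h : ℝ) + 1) ^ (n - 1) * ψ ((h : ℝ) + 1) := by
  have hF : ∀ h : ℕ, 0 ≤ ((h : ℝ) + 1) ^ (n - 1) * ψ ((h : ℝ) + 1) := fun h => by
    have := (hψpos ((h : ℝ) + 1) (by positivity)).le
    positivity
  have hg : ∀ k : ℕ, 0 ≤ (2 : ℝ) ^ (k * n) * ψ (2 ^ k) := fun k => by
    have := (hψpos (2 ^ k) (by positivity)).le
    positivity
  have hblock : ∀ K : ℕ, ∑ h ∈ Finset.range (2 ^ K - 1),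
      ((h : ℝ) + 1) ^ (n - 1) * ψ ((h : ℝ) + 1) ≤
        ∑ k ∈ Finset.range K, 2 ^ (n - 1) * ((2 : ℝ) ^ (k * n) * ψ (2 ^ k)) := by
    intro K
    induction K with
    | zero => simp
    | succ K ih =>
      have hK : 1 ≤ 2 ^ K := Nat.one_le_two_pow
      rw [show 2 ^ (K + 1) - 1 = (2 ^ K - 1) + 2 ^ K by rw [pow_succ]; omega,
        Finset.sum_range_add, Finset.sum_range_succ]
      refine add_le_add ih ?_
      have hterm : ∀ x ∈ Finset.range (2 ^ K),
          (((2 ^ K - 1 + x : ℕ) : ℝ) + 1) ^ (n - 1) * ψ (((2 ^ K - 1 + x : ℕ) : ℝ) + 1) ≤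
            (2 ^ (K + 1)) ^ (n - 1) * ψ (2 ^ K) := by
        intro x hx
        have hx' : (x : ℝ) ≤ 2 ^ K := by exact_mod_cast (Finset.mem_range.1 hx).le
        have hcast : ((2 ^ K - 1 + x : ℕ) : ℝ) + 1 = 2 ^ K + x := by
          push_cast [Nat.cast_sub hK]
          ring
        rw [hcast]
        have h1 : ψ (2 ^ K + x) ≤ ψ (2 ^ K) :=
          hψdec (show (0 : ℝ) < 2 ^ K by positivity) (show (0 : ℝ) < 2 ^ K + x by positivity)
            (by simp)
        have h2 := (hψpos (2 ^ K + x) (by positivity)).le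
        gcongr
        rw [pow_succ]
        linarith
      refine (Finset.sum_le_sum hterm).trans (le_of_eq ?_)
      obtain ⟨p, rfl⟩ : ∃ p, n = p + 1 := ⟨n - 1, by omega⟩
      rw [Finset.sum_const, Finset.card_range, nsmul_eq_mul, Nat.add_sub_cancel]
      push_cast
      ring
  refine summable_of_sum_range_le hF
    (c := ∑' k : ℕ, 2 ^ (n - 1) * ((2 : ℝ) ^ (k * n) * ψ (2 ^ k))) fun N => ?_
  have hN : N ≤ 2 ^ N - 1 := by have := Nat.lt_two_pow_self (n := N); omega
  calc _ ≤ ∑ h ∈ Finset.range (2 ^ N - 1), ((h : ℝ) + 1) ^ (n - 1) * ψ ((h : ℝ) + 1) :=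
        Finset.sum_le_sum_of_subset_of_nonneg (Finset.range_subset_range.2 hN) fun h _ _ => hF h
    _ ≤ _ := hblock N
    _ ≤ _ := (h.mul_left _).sum_le_tsum _ fun k _ => mul_nonneg (by positivity) (hg k)

theorem not_summable_min_dyadic {n : ℕ} (hn : 1 ≤ n) {ψ : ℝ → ℝ}
    (hψpos : ∀ q : ℝ, 0 < q → 0 < ψ q) (hψdec : AntitoneOn ψ (Ioi 0))
    (hdiv : ¬ Summable fun h : ℕ => ((h : ℝ) + 1) ^ (n - 1) * ψ ((h : ℝ) + 1))
    {C : ℝ} (hC : 0 < C) (m : ℕ) :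
    ¬ Summable fun k : ℕ => min ((2 : ℝ) ^ (k * n) * ψ (2 ^ (k + m)) / C) 1 := by
  intro hsum
  refine hdiv (summable_of_summable_dyadic hn hψpos hψdec ?_)
  have hlt := hsum.tendsto_atTop_zero.eventually_lt_const (zero_lt_one (α := ℝ))
  obtain ⟨N, hN⟩ := eventually_atTop.1 hlt
  have h1 : Summable fun k : ℕ => (2 : ℝ) ^ (k * n) * ψ (2 ^ (k + m)) / C := by
    rw [← summable_nat_add_iff N] at hsum ⊢
    refine hsum.congr fun k => ?_
    have := hN (k + N) (by omega)
    rw [min_lt_iff] at this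
    exact min_eq_left (this.resolve_right (lt_irrefl _)).le
  rw [← summable_nat_add_iff m]
  refine (h1.mul_left (C * 2 ^ (m * n))).congr fun k => ?_
  rw [add_mul, pow_add, mul_div_assoc']
  rw [div_eq_iff hC.ne']
  ring

theorem measure_sdiff_eq_zero_of_density {U E : Set ℝ} (hE : MeasurableSet E)
    {κ : ℝ} (hκ : 0 < κ) (h : ∀ x ∈ U, ∀ᶠ r in nhdsWithin (0 : ℝ) (Ioi 0),
      ENNReal.ofReal (κ * r) ≤ volume (Metric.closedBall x (3 * r) ∩ E)) :
    volume (U \ E) = 0 := by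
  have hae := Besicovitch.ae_tendsto_measure_inter_div volume (U \ E)
  have hnull := Measure.measure_inter_eq_zero_of_restrict hae
  refine measure_mono_null ?_ hnull
  intro x hx
  refine ⟨?_, hx⟩
  intro hlim
  have h3 : Tendsto (fun r : ℝ => 3 * r) (nhdsWithin 0 (Ioi 0)) (nhdsWithin 0 (Ioi 0)) := by
    refine tendsto_nhdsWithin_iff.2 ⟨?_, ?_⟩
    · have : Tendsto (fun r : ℝ => 3 * r) (nhds 0) (nhds (3 * 0)) := tendsto_id.const_mul 3
      rw [mul_zero] at this
      exact this.mono_left nhdsWithin_le_nhds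
    · filter_upwards [self_mem_nhdsWithin] with r hr
      exact mul_pos three_pos (mem_Ioi.1 hr)
  have hlim3 := hlim.comp h3
  have hlt : ENNReal.ofReal (1 - κ / 6) < 1 := by
    rw [ENNReal.ofReal_lt_one]
    linarith
  obtain ⟨r, hr, hr1, hr0⟩ := ((hlim3.eventually_const_lt hlt).and
    ((h x hx.1).and self_mem_nhdsWithin)).exists
  refine absurd hr (not_lt.2 ?_)
  simp only [Function.comp]
  have hadd := measure_inter_add_sdiff (μ := volume) (Metric.closedBall x (3 * r)) hE
  have hsub : (U \ E) ∩ Metric.closedBall x (3 * r) ⊆ Metric.closedBall x (3 * r) \ E :=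
    fun y hy => ⟨hy.2, hy.1.2⟩
  have hle : volume ((U \ E) ∩ Metric.closedBall x (3 * r)) ≤ ENNReal.ofReal (6 * r - κ * r) := by
    rw [ENNReal.ofReal_sub _ (by positivity)]
    refine ENNReal.le_sub_of_add_le_left ENNReal.ofReal_ne_top ?_
    refine (add_le_add hr1 (measure_mono hsub)).trans ?_
    rw [hadd, Real.volume_closedBall]
    exact ENNReal.ofReal_le_ofReal (by linarith)
  rw [Real.volume_closedBall]
  refine ENNReal.div_le_of_le_mul (hle.trans ?_)
  rw [← ENNReal.ofReal_mul' (by positivity)]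
  exact ENNReal.ofReal_le_ofReal (by linarith)

/-- Points whose distance to the zero of an affine form of height about `2 ^ k` is small infinitely
often have infinitely many approximating integer vectors. -/
theorem infinite_approximations {n : ℕ} {V : Set ℝ} (f : Fin n → ℝ → ℝ) (lam ψ : ℝ → ℝ)
    (hψdec : AntitoneOn ψ (Ioi 0)) {c₁ C₁ C₃ : ℝ} (hc₁ : 0 < c₁) {m : ℕ}
    (hm : C₁ ≤ 2 ^ m) {x : ℝ} (hx : x ∈ V)
    (hfreq : ∃ᶠ k : ℕ in atTop, ∃ z : ℝ, (∃ (v : Fin n → ℤ) (v₀ : ℤ),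
        (∀ i, |(v i : ℝ)| ≤ C₁ * 2 ^ k) ∧ (∃ i, c₁ * 2 ^ k ≤ |(v i : ℝ)|) ∧
        ∀ t ∈ V, |v₀ + ∑ i, (v i : ℝ) * f i t + lam t| ≤ C₃ * 2 ^ k * |t - z|) ∧
      C₃ * 2 ^ k * |x - z| < ψ (2 ^ (k + m))) :
    {c : Fin n → ℤ | c ≠ 0 ∧ nearestIntDist ((∑ i, (c i : ℝ) * f i x) + lam x) <
      ψ ((Finset.univ.sup fun i => (c i).natAbs : ℕ) : ℝ)}.Infinite := by
  intro hfin
  obtain ⟨B, hB⟩ := (hfin.image fun c : Fin n → ℤ => ∑ i, |(c i : ℝ)|).bddAbove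
  have hlarge : ∀ᶠ k : ℕ in atTop, B < c₁ * 2 ^ k :=
    ((tendsto_pow_atTop_atTop_of_one_lt (one_lt_two (α := ℝ))).const_mul_atTop hc₁).eventually_gt_atTop B
  obtain ⟨k, ⟨z, ⟨v, v₀, hv, ⟨i, hi⟩, hvt⟩, hxz⟩, hk⟩ := (hfreq.and_eventually hlarge).exists
  have hvi : 0 < |(v i : ℝ)| := lt_of_lt_of_le (by positivity) hi
  refine absurd (hB (mem_image_of_mem _ (x := v) ⟨?_, ?_⟩)) (not_le.2 ?_)
  · rintro rfl
    simp at hvi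
  · refine lt_of_le_of_lt ?_ (lt_of_lt_of_le ((hvt x hx).trans_lt hxz) ?_)
    · refine (round_le _ (-v₀)).trans (le_of_eq ?_)
      push_cast
      ring_nf
    · refine hψdec ?_ (show (0 : ℝ) < 2 ^ (k + m) by positivity) ?_
      · have h1 : (v i).natAbs ≤ Finset.univ.sup fun i => (v i).natAbs :=
          Finset.le_sup (f := fun i => (v i).natAbs) (Finset.mem_univ i)
        have h2 : 0 < (v i).natAbs := by
          rw [Int.natAbs_pos]
          rintro h0
          simp [h0] at hvi
        exact mem_Ioi.2 (Nat.cast_pos.2 (h2.trans_le h1))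
      · have h1 : (Finset.univ.sup fun i => (v i).natAbs) ≤ 2 ^ (k + m) := by
          refine Finset.sup_le fun j _ => ?_
          have h2 := hv j
          have h3 : ((v j).natAbs : ℝ) ≤ 2 ^ (k + m) := by
            rw [Nat.cast_natAbs, Int.cast_abs, pow_add, mul_comm]
            exact h2.trans (by gcongr)
          exact_mod_cast h3
        exact_mod_cast h1
  · exact (hk.trans_le hi).trans_le
      (Finset.single_le_sum (f := fun i => |(v i : ℝ)|) (fun _ _ => abs_nonneg _)
        (Finset.mem_univ i))

theorem exists_nhds_ae_infinite {n : ℕ} (hn : 1 ≤ n) {a b : ℝ} (hab : a < b)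
    (f : Fin n → ℝ → ℝ) (hf : ∀ i, ContDiffOn ℝ n (f i) (Icc a b)) {x₀ : ℝ} (hx₀ : x₀ ∈ Ioo a b)
    (hW : (Matrix.of fun i j : Fin n =>
      iteratedDerivWithin ((j : ℕ) + 1) (f i) (Icc a b) x₀).det ≠ 0)
    (ψ : ℝ → ℝ) (hψpos : ∀ q : ℝ, 0 < q → 0 < ψ q) (hψdec : AntitoneOn ψ (Ioi 0))
    (lam : ℝ → ℝ) (hlam : ContDiffOn ℝ 2 lam (Icc a b))
    (hdiv : ¬ Summable fun h : ℕ => ((h : ℝ) + 1) ^ (n - 1) * ψ ((h : ℝ) + 1)) :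
    ∃ U ∈ nhds x₀, volume (U \ {x |
        {c : Fin n → ℤ | c ≠ 0 ∧ nearestIntDist ((∑ i, (c i : ℝ) * f i x) + lam x) <
            ψ ((Finset.univ.sup fun i => (c i).natAbs : ℕ) : ℝ)}.Infinite}) = 0 := by
  obtain ⟨R, A₁, A₂, κ, s, i₀, hR, hκ, hs, hball, hnd, hκD⟩ :=
    exists_uniformlyNondegenerate hn hab f hf hx₀ hW
  obtain ⟨lam', L, hL, hlam'⟩ := exists_bounded_derivative hab hlam
  obtain ⟨ε, hε, hshort⟩ := hnd.measure_short_vectors hn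
  obtain ⟨τ, c₁, C₁, C₃, hτ, hc₁, hC₁, hC₃, happ⟩ := hnd.exists_approximation hn
    (convex_closedBall x₀ R) hκ hs hκD hL (fun t ht => hlam' t (hball ht)) hε
  set V := Metric.closedBall x₀ R with hV
  obtain ⟨m, hm⟩ := pow_unbounded_of_one_lt C₁ one_lt_two
  set θ : ℝ := (1 / 2) ^ (n + 1) with hθ
  have hθ0 : 0 < θ := by positivity
  have hθ2 : θ ≤ 1 / 2 := pow_le_of_le_one (by norm_num) (by norm_num) n.succ_ne_zero
  have hθk : ∀ k : ℕ, (2 ^ k : ℝ) ^ (n + 1) * θ ^ k = 1 := fun k => by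
    rw [hθ, ← pow_mul, ← pow_mul, mul_comm (n + 1) k, ← mul_pow]
    norm_num
  set t : ℕ → ℝ := fun k => min ((2 : ℝ) ^ (k * n) * ψ (2 ^ (k + m)) / C₃) 1 with ht
  have ht0 : ∀ k, 0 < t k := fun k => by
    have := hψpos (2 ^ (k + m)) (by positivity)
    exact lt_min (by positivity) one_pos
  have ht1 : ∀ k, t k ≤ 1 := fun k => min_le_right _ _
  have htd : ¬ Summable t := not_summable_min_dyadic hn hψpos hψdec hdiv hC₃ m
  set Z : ℕ → Set ℝ := fun k => {z | ∃ (v : Fin n → ℤ) (v₀ : ℤ),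
    (∀ i, |(v i : ℝ)| ≤ C₁ * 2 ^ k) ∧ (∃ i, c₁ * 2 ^ k ≤ |(v i : ℝ)|) ∧
    ∀ t ∈ V, |v₀ + ∑ i, (v i : ℝ) * f i t + lam t| ≤ C₃ * 2 ^ k * |t - z|} with hZ
  set E := limsup (fun k => ⋃ z ∈ Z k, Metric.ball z (t k * θ ^ k)) atTop with hE
  have hEm : MeasurableSet E := MeasurableSet.measurableSet_limsup fun k =>
    (isOpen_biUnion fun z _ => Metric.isOpen_ball).measurableSet
  refine ⟨Metric.ball x₀ R, Metric.ball_mem_nhds _ hR, ?_⟩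
  have hdens : volume (Metric.ball x₀ R \ E) = 0 := by
    refine measure_sdiff_eq_zero_of_density hEm (κ := 1 / (24 * (τ + 2) ^ 2)) (by positivity)
      fun x hx => ?_
    rw [Metric.mem_ball] at hx
    set d := R - dist x x₀ with hd
    have hd0 : 0 < d := by linarith
    have hsmall : ∀ᶠ r in nhdsWithin (0 : ℝ) (Ioi 0), r < d / 3 ^ (n + 1) :=
      nhdsWithin_le_nhds (Iio_mem_nhds (by positivity))
    filter_upwards [hsmall, self_mem_nhdsWithin] with r hr hr0
    rw [mem_Ioi] at hr0
    rw [lt_div_iff₀ (by positivity)] at hr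
    have hr2 : 2 * r ≤ d := by
      have : (2 : ℝ) ≤ 3 ^ (n + 1) :=
        le_trans (by norm_num) (le_self_pow₀ (by norm_num : (1 : ℝ) ≤ 3) n.succ_ne_zero)
      nlinarith
    obtain ⟨Q, hQ1, hQ⟩ := hshort x r hr0 (Metric.closedBall_subset_closedBall' (by linarith))
    have hlim : Tendsto (fun k => τ * θ ^ k) atTop (nhds 0) := by
      simpa using (tendsto_pow_atTop_nhds_zero_of_lt_one hθ0.le (by linarith)).const_mul τ
    obtain ⟨K, hK⟩ := eventually_atTop.1 ((hlim.eventually_le_const (half_pos hd0)).and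
      ((tendsto_pow_atTop_atTop_of_one_lt (one_lt_two (α := ℝ))).eventually_ge_atTop Q))
    rw [one_div_mul_eq_div]
    refine volume_limsup_neighborhoods_ge Z hr0 hτ hθ0 hθ2 t ht0 ht1 htd K fun k hk => ?_
    obtain ⟨hk1, hk2⟩ := hK k hk
    have hshort' := hQ (2 ^ k) hk2
    have hτk : τ / (2 ^ k : ℝ) ^ (n + 1) = τ * θ ^ k := by
      rw [div_eq_iff (by positivity), mul_assoc, mul_comm (θ ^ k), hθk, mul_one]
    have hcover := measure_le_inter_add_sdiff volume (Metric.closedBall x r)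
      {y | ∀ v : Fin (n + 1) → ℤ, v ≠ 0 → ε ≤ ‖(flowMatrix n (2 ^ k) (liftCurve
        (fun i => iteratedDerivWithin 0 (f i) (Icc a b)) y)).mulVec fun k => (v k : ℝ)‖}
    have hsplit := hcover.trans (add_le_add_right hshort' _)
    rw [Real.volume_closedBall, two_mul, ENNReal.ofReal_add hr0.le hr0.le] at hsplit
    refine (ENNReal.le_of_add_le_add_right ENNReal.ofReal_ne_top hsplit).trans (measure_mono ?_)
    rintro y ⟨hy, hgood⟩
    refine ⟨hy, ?_⟩
    rw [Metric.mem_closedBall] at hy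
    have hyV : Metric.closedBall y (τ / (2 ^ k : ℝ) ^ (n + 1)) ⊆ V := by
      refine Metric.closedBall_subset_closedBall' ?_
      rw [hτk]
      have := dist_triangle y x x₀
      linarith
    obtain ⟨v, v₀, z, hz, h1, h2, h3⟩ := happ (2 ^ k) (one_le_pow₀ one_le_two) y hyV hgood
    refine ⟨z, ⟨v, v₀, h1, h2, ?_⟩, ?_⟩
    · simpa only [iteratedDerivWithin_zero] using h3
    · rwa [hτk, Metric.mem_closedBall, Real.dist_eq, abs_sub_comm] at hz
  refine measure_mono_null ?_ hdens
  intro x hx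
  refine ⟨hx.1, fun hxE => hx.2 ?_⟩
  refine infinite_approximations (C₃ := C₃) f lam ψ hψdec hc₁ hm.le
    (Metric.ball_subset_closedBall hx.1) ?_
  rw [hE, mem_limsup_iff_frequently_mem] at hxE
  refine hxE.mono fun k hk => ?_
  obtain ⟨z, hz, hxz⟩ := mem_iUnion₂.1 hk
  refine ⟨z, hz, ?_⟩
  rw [Metric.mem_ball, Real.dist_eq] at hxz
  have htk : t k * C₃ ≤ (2 : ℝ) ^ (k * n) * ψ (2 ^ (k + m)) := by
    rw [← le_div_iff₀ hC₃]
    exact min_le_left _ _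
  have hpow : (2 : ℝ) ^ (k * n) * 2 ^ k * θ ^ k = 1 := by
    rw [← hθk k, pow_succ, pow_mul]
  calc C₃ * 2 ^ k * |x - z| < C₃ * 2 ^ k * (t k * θ ^ k) := by gcongr
    _ = (t k * C₃) * (2 ^ k * θ ^ k) := by ring
    _ ≤ ((2 : ℝ) ^ (k * n) * ψ (2 ^ (k + m))) * (2 ^ k * θ ^ k) := by gcongr
    _ = ψ (2 ^ (k + m)) * (2 ^ (k * n) * 2 ^ k * θ ^ k) := by ring
    _ = ψ (2 ^ (k + m)) := by rw [hpow, mul_one]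

theorem stmt_2 (n : ℕ) (hn : 1 ≤ n) (a b : ℝ) (hab : a < b)
    (f : Fin n → ℝ → ℝ) (hf : ∀ i, ContDiffOn ℝ n (f i) (Icc a b))
    (hW : ∀ x ∈ Icc a b,
      (Matrix.of fun i j : Fin n =>
        iteratedDerivWithin ((j : ℕ) + 1) (f i) (Icc a b) x).det ≠ 0)
    (ψ : ℝ → ℝ) (hψpos : ∀ q : ℝ, 0 < q → 0 < ψ q)
    (hψdec : AntitoneOn ψ (Ioi 0))
    (lam : ℝ → ℝ) (hlam : ContDiffOn ℝ 2 lam (Icc a b))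
    (hdiv : ¬ Summable fun h : ℕ => ((h : ℝ) + 1) ^ (n - 1) * ψ ((h : ℝ) + 1)) :
    volume {x ∈ Icc a b |
        {c : Fin n → ℤ | c ≠ 0 ∧
          nearestIntDist ((∑ i, (c i : ℝ) * f i x) + lam x) <
            ψ ((Finset.univ.sup fun i => (c i).natAbs : ℕ) : ℝ)}.Infinite} =
      volume (Icc a b) := by
  set A : Set ℝ := {x | {c : Fin n → ℤ | c ≠ 0 ∧
    nearestIntDist ((∑ i, (c i : ℝ) * f i x) + lam x) <
      ψ ((Finset.univ.sup fun i => (c i).natAbs : ℕ) : ℝ)}.Infinite} with hA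
  have hnull : volume (Ioo a b \ A) = 0 := by
    refine measure_null_of_locally_null _ fun x hx => ?_
    obtain ⟨U, hU, hU0⟩ := exists_nhds_ae_infinite hn hab f hf hx.1
      (hW x (Ioo_subset_Icc_self hx.1)) ψ hψpos hψdec lam hlam hdiv
    exact ⟨U ∩ (Ioo a b \ A), inter_mem (mem_nhdsWithin_of_mem_nhds hU) self_mem_nhdsWithin,
      measure_mono_null (inter_subset_inter_right U fun y hy => hy.2) hU0⟩
  refine le_antisymm (measure_mono fun x hx => hx.1) ?_
  rw [← Ioo_ae_eq_Icc.measure_eq]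
  refine (measure_le_inter_add_sdiff volume (Ioo a b) A).trans ?_
  rw [hnull, add_zero]
  exact measure_mono fun x hx => ⟨Ioo_subset_Icc_self hx.1, hx.2⟩
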